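/- arXiv:2212.13862 — 4 statements merged into one kernel-verified Lean document; each statement's English description precedes it below -/
import Mathlib

section
/- Fix d ≥ 1, a set A ⊆ (0, ∞) satisfying ACC, and t > 0. There exists ε > 0, depending only on d and A, with the following property. Let (e_i)_{i ∈ I} be a finite family of primitive vectors of ℤ^d spanning ℝ^d, and let (a_i)_{i ∈ I} be real numbers with 0 ≤ a_i ≤ 1 for all i and a_i / t ∈ A whenever a_i > 0. Set U = conv({0} ∪ {(1/a_i) • e_i : a_i > 0}) + Σ_{i : a_i = 0} ℝ_{≥0} • e_i (the Minkowski sum of the convex hull with the cone generated by those e_i with a_i = 0). Then the following are equivalent: (a) ℤ^d ∩ interior(t • U) = ∅; (b) there exist an integer p with 1 ≤ p ≤ d and a surjective linear map π : ℝ^d → ℝ^p with π(ℤ^d) = ℤ^p such that π(U) is a bounded set, ℤ^p ∩ interior(t • π(U)) = ∅, and for every nonzero v ∈ ℤ^p and every s with 0 < s < ε, v ∉ s • (t • π(U) − t • π(U)). -/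
open Pointwise

/-- The integer lattice `ℤ^d` inside `ℝ^d`. -/
def intLat (d : ℕ) : Set (Fin d → ℝ) := {x | ∀ i, ∃ z : ℤ, x i = (z : ℝ)}

/-- A vector of `ℤ^d` is primitive if it is nonzero and the gcd of its coordinates is `1`. -/
def Primitive {d : ℕ} (e : Fin d → ℤ) : Prop :=
  e ≠ 0 ∧ Finset.univ.gcd (fun i => (e i).natAbs) = 1

/-- A set of reals satisfies the ascending chain condition if it admits no strictly
increasing sequence. -/
def ACCSet (A : Set ℝ) : Prop := ¬ ∃ f : ℕ → ℝ, StrictMono f ∧ ∀ n, f n ∈ A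

/-- The real vector associated to an integer vector. -/
def toReal {d : ℕ} (e : Fin d → ℤ) : Fin d → ℝ := fun i => (e i : ℝ)


open Filter Topology in
theorem AddSubgroup.exists_norm_lt_imp_smul_mem {E : Type*} [NormedAddCommGroup E]
    [NormedSpace ℝ E] [FiniteDimensional ℝ E] (L : AddSubgroup E) (hL : IsClosed (L : Set E)) :
    ∃ ρ : ℝ, 0 < ρ ∧ ∀ x ∈ L, ‖x‖ < ρ → ∀ c : ℝ, c • x ∈ L := by
  by_contra! h
  have : ProperSpace E := FiniteDimensional.proper ℝ E
  let V : Submodule ℝ E :=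
    { carrier := {x | ∀ c : ℝ, c • x ∈ L}
      add_mem' := fun {x y} hx hy c => by
        rw [smul_add]; exact L.add_mem (hx c) (hy c)
      zero_mem' := fun c => by rw [smul_zero]; exact L.zero_mem
      smul_mem' := fun k x hx c => by rw [smul_smul]; exact hx _ }
  have hVL : ∀ x ∈ V, x ∈ L := fun x hx => by simpa using hx 1
  have hVc : IsClosed (V : Set E) := V.closed_of_finiteDimensional
  have key : ∀ n : ℕ, ∃ x ∈ L, x ≠ 0 ∧ ‖x‖ < 1 / ((n : ℝ) + 1) ∧ ∀ y ∈ V, ‖x‖ ≤ ‖x - y‖ := by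
    intro n
    obtain ⟨x, hx, hxn, c, hc⟩ := h (1 / ((n : ℝ) + 1)) (by positivity)
    obtain ⟨y₀, hy₀, hd⟩ := hVc.exists_infDist_eq_dist ⟨0, V.zero_mem⟩ x
    refine ⟨x - y₀, L.sub_mem hx (hVL _ hy₀), ?_, ?_, ?_⟩
    · intro h0
      rw [sub_eq_zero] at h0
      exact hc (h0 ▸ hy₀ c)
    · rw [← dist_eq_norm, ← hd]
      refine (Metric.infDist_le_dist_of_mem V.zero_mem).trans_lt ?_
      rwa [dist_zero_right]
    · intro y hy
      rw [← dist_eq_norm, ← hd, sub_sub, ← dist_eq_norm]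
      exact Metric.infDist_le_dist_of_mem (V.add_mem hy₀ hy)
  choose x hxL hx0 hxn hxV using key
  have hpos : ∀ n, 0 < ‖x n‖ := fun n => norm_pos_iff.2 (hx0 n)
  obtain ⟨a, -, φ, hφ, ha⟩ := (isCompact_sphere (0 : E) 1).tendsto_subseq
    (x := fun n => ‖x n‖⁻¹ • x n) (fun n => by
      simp [norm_smul, (hpos n).ne'])
  have hlim : Tendsto (fun n => ‖x (φ n)‖) atTop (𝓝 0) := by
    have h1 : Tendsto (fun n => ‖x n‖) atTop (𝓝 0) :=
      squeeze_zero (fun n => norm_nonneg _) (fun n => (hxn n).le)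
        tendsto_one_div_add_atTop_nhds_zero_nat
    exact h1.comp hφ.tendsto_atTop
  have haV : a ∈ V := by
    intro c
    have hs : Tendsto (fun n => (⌊c / ‖x (φ n)‖⌋ : ℝ) * ‖x (φ n)‖) atTop (𝓝 c) := by
      have h2 : Tendsto (fun n => c - ‖x (φ n)‖) atTop (𝓝 c) := by
        simpa using tendsto_const_nhds.sub hlim
      refine tendsto_of_tendsto_of_tendsto_of_le_of_le h2 tendsto_const_nhds ?_ ?_
      · intro n
        have h3 := Int.lt_floor_add_one (c / ‖x (φ n)‖)
        rw [div_lt_iff₀ (hpos _)] at h3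
        simp only
        linarith
      · intro n
        have h3 := Int.floor_le (c / ‖x (φ n)‖)
        rwa [le_div_iff₀ (hpos _)] at h3
    refine hL.mem_of_tendsto (hs.smul ha) (Eventually.of_forall fun n => ?_)
    simp only [Function.comp, smul_smul, mul_assoc, mul_inv_cancel₀ (hpos (φ n)).ne', mul_one]
    rw [Int.cast_smul_eq_zsmul]
    exact L.zsmul_mem (hxL _) _
  obtain ⟨n, hn⟩ := (Metric.tendsto_atTop.1 ha 1 one_pos)
  have h4 := hn n le_rfl
  rw [dist_eq_norm] at h4
  have h5 := hxV (φ n) (‖x (φ n)‖ • a) (V.smul_mem _ haV)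
  have h6 : x (φ n) - ‖x (φ n)‖ • a
      = ‖x (φ n)‖ • (((fun n => ‖x n‖⁻¹ • x n) ∘ φ) n - a) := by
    simp only [Function.comp, smul_sub, smul_smul, mul_inv_cancel₀ (hpos (φ n)).ne', one_smul]
  rw [h6, norm_smul, norm_norm] at h5
  nlinarith [hpos (φ n)]

theorem AddSubgroup.exists_le_of_forall_norm_sub_lt {E : Type*} [NormedAddCommGroup E]
    [NormedSpace ℝ E] [FiniteDimensional ℝ E] (L : AddSubgroup E) (hL : IsClosed (L : Set E)) :
    ∃ ρ : ℝ, 0 < ρ ∧ ∀ H : AddSubgroup E, (∀ h ∈ H, ∃ l ∈ L, ‖h - l‖ < ρ) → H ≤ L := by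
  have : ProperSpace E := FiniteDimensional.proper ℝ E
  obtain ⟨ρ, hρ, hdisc⟩ := L.exists_norm_lt_imp_smul_mem hL
  refine ⟨ρ / 3, by positivity, fun H hH h hh => ?_⟩
  obtain ⟨l, hl, hd⟩ := hL.exists_infDist_eq_dist ⟨0, L.zero_mem⟩ h
  have hmin : ∀ l' ∈ L, ‖h - l‖ ≤ ‖(h - l) - l'‖ := by
    intro l' hl'
    rw [← dist_eq_norm, ← hd, sub_sub, ← dist_eq_norm]
    exact Metric.infDist_le_dist_of_mem (L.add_mem hl hl')
  obtain ⟨l₁, hl₁, hlt₁⟩ := hH h hh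
  have hlt : ‖h - l‖ < ρ / 3 := by
    refine lt_of_le_of_lt ?_ hlt₁
    rw [← dist_eq_norm, ← hd, ← dist_eq_norm]
    exact Metric.infDist_le_dist_of_mem hl₁
  by_cases h0 : h - l = 0
  · rw [sub_eq_zero] at h0
    exact h0 ▸ hl
  exfalso
  have hpos : 0 < ‖h - l‖ := norm_pos_iff.2 h0
  set k : ℕ := ⌈ρ / 3 / ‖h - l‖⌉₊ with hk
  have hk1 : ρ / 3 ≤ k * ‖h - l‖ := by
    have := Nat.le_ceil (ρ / 3 / ‖h - l‖)
    rwa [div_le_iff₀ hpos] at this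
  have hk2 : k * ‖h - l‖ < 2 * (ρ / 3) := by
    have := Nat.ceil_lt_add_one (a := ρ / 3 / ‖h - l‖) (by positivity)
    rw [← hk, ← sub_lt_iff_lt_add, lt_div_iff₀ hpos] at this
    linarith
  have hk0 : (0 : ℝ) < k := by
    by_contra hcon
    have : (k : ℝ) = 0 := le_antisymm (not_lt.1 hcon) (Nat.cast_nonneg k)
    rw [this] at hk1
    linarith
  obtain ⟨l₂, hl₂, hlt₂⟩ := hH (k • h) (H.nsmul_mem hh k)
  have hl₃ : l₂ - k • l ∈ L := L.sub_mem hl₂ (L.nsmul_mem hl k)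
  have e1 : l₂ - k • l = (k : ℝ) • (h - l) - (k • h - l₂) := by
    rw [smul_sub, Nat.cast_smul_eq_nsmul, Nat.cast_smul_eq_nsmul]
    abel
  have hn₃ : ‖l₂ - k • l‖ < ρ := by
    rw [e1]
    refine (norm_sub_le _ _).trans_lt ?_
    rw [norm_smul, Real.norm_natCast]
    linarith
  have h7 := hmin _ (hdisc _ hl₃ hn₃ (k : ℝ)⁻¹)
  rw [e1, smul_sub, smul_smul, inv_mul_cancel₀ hk0.ne', one_smul, sub_sub_cancel, norm_smul,
    norm_inv, Real.norm_natCast, inv_mul_eq_div, le_div_iff₀ hk0] at h7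
  linarith

theorem ACCSet.bddAbove {A : Set ℝ} (hA : ACCSet A) : BddAbove A := by
  by_contra h
  rw [not_bddAbove_iff] at h
  obtain ⟨x₀, hx₀, -⟩ := h 0
  have : Nonempty A := ⟨⟨x₀, hx₀⟩⟩
  have : NoMaxOrder A := ⟨fun a => by
    obtain ⟨y, hy, hlt⟩ := h a
    exact ⟨⟨y, hy⟩, hlt⟩⟩
  obtain ⟨f, hf⟩ := Nat.exists_strictMono A
  exact hA ⟨fun n => f n, fun m n hmn => hf hmn, fun n => (f n).2⟩

theorem ACCSet.exists_gap {A : Set ℝ} (hA : ACCSet A) (b : ℝ) :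
    ∃ η : ℝ, 0 < η ∧ ∀ a ∈ A, a < b → a ≤ b - η := by
  by_contra! h
  have hlub : IsLUB (A ∩ Set.Iio b) b := by
    refine ⟨fun x hx => hx.2.le, fun u hu => ?_⟩
    by_contra! hub
    obtain ⟨a, ha, hab, hlt⟩ := h (b - u) (by linarith)
    have := hu ⟨ha, hab⟩
    linarith
  obtain ⟨a, ha, hab, -⟩ := h 1 one_pos
  obtain ⟨u, hu, -, -, hmem⟩ := hlub.exists_seq_strictMono_tendsto_of_notMem
    (fun hb => lt_irrefl b (Set.mem_Iio.1 hb.2)) ⟨a, ha, hab⟩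
  exact hA ⟨u, hu, fun n => (hmem n).1⟩

open Filter Topology in
theorem ACCSet.eventually_le {A : Set ℝ} (hA : ACCSet A) {l : Filter ℕ} {f : ℕ → ℝ} {b : ℝ}
    (hf : ∀ n, f n ∈ A ∨ f n = 0) (hf0 : ∀ n, 0 ≤ f n) (hb : Tendsto f l (𝓝 b)) :
    ∀ᶠ n in l, b ≤ f n := by
  rcases le_or_gt b 0 with h0 | h0
  · exact Eventually.of_forall fun n => h0.trans (hf0 n)
  · obtain ⟨η, hη, hgap⟩ := hA.exists_gap b
    filter_upwards [hb.eventually_const_lt (show b - η < b by linarith),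
      hb.eventually_const_lt h0] with n h1 h2
    by_contra! hlt
    rcases hf n with h | h
    · linarith [hgap _ h hlt]
    · linarith

/-- The lower limit of a sequence of additive subgroups along a filter: the points all of whose
neighbourhoods eventually meet the subgroups. -/
def limitSubgroup {E : Type*} [NormedAddCommGroup E] (l : Filter ℕ) (G : ℕ → AddSubgroup E) :
    AddSubgroup E where
  carrier := {x | ∀ ρ : ℝ, 0 < ρ → ∀ᶠ n in l, ∃ y ∈ G n, ‖y - x‖ < ρ}
  add_mem' := by
    intro x x' hx hx' ρ hρ
    filter_upwards [hx (ρ / 2) (by positivity), hx' (ρ / 2) (by positivity)]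
      with n ⟨y, hy, h⟩ ⟨y', hy', h'⟩
    refine ⟨y + y', (G n).add_mem hy hy', ?_⟩
    rw [add_sub_add_comm]
    exact (norm_add_le _ _).trans_lt (by linarith)
  zero_mem' := fun ρ hρ => Filter.Eventually.of_forall fun n => ⟨0, (G n).zero_mem, by simpa⟩
  neg_mem' := by
    intro x hx ρ hρ
    filter_upwards [hx ρ hρ] with n ⟨y, hy, h⟩
    refine ⟨-y, (G n).neg_mem hy, ?_⟩
    rwa [← neg_add', norm_neg, ← sub_eq_add_neg]

theorem isClosed_limitSubgroup {E : Type*} [NormedAddCommGroup E] (l : Filter ℕ)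
    (G : ℕ → AddSubgroup E) : IsClosed (limitSubgroup l G : Set E) := by
  refine isClosed_of_closure_subset fun x hx ρ hρ => ?_
  obtain ⟨y, hy, hxy⟩ := Metric.mem_closure_iff.1 hx (ρ / 2) (by positivity)
  filter_upwards [hy (ρ / 2) (by positivity)] with n ⟨z, hz, h⟩
  refine ⟨z, hz, ?_⟩
  rw [dist_comm, dist_eq_norm] at hxy
  calc ‖z - x‖ = ‖(z - y) + (y - x)‖ := by congr 1; abel
    _ ≤ ‖z - y‖ + ‖y - x‖ := norm_add_le _ _
    _ < ρ := by linarith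

theorem mem_limitSubgroup_of_forall {E : Type*} [NormedAddCommGroup E] {l : Filter ℕ}
    {G : ℕ → AddSubgroup E} {x : E} (hx : ∀ n, x ∈ G n) : x ∈ limitSubgroup l G :=
  fun ρ hρ => Filter.Eventually.of_forall fun n => ⟨x, hx n, by simpa⟩

open Filter Topology in
theorem eventually_le_limitSubgroup {ι : Type*} [Fintype ι] (l : Ultrafilter ℕ)
    (G : ℕ → AddSubgroup (ι → ℝ)) (hG : ∀ n (z : ι → ℤ), (fun i => (z i : ℝ)) ∈ G n) :
    ∀ᶠ n in (l : Filter ℕ), G n ≤ limitSubgroup l G := by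
  set L := limitSubgroup (l : Filter ℕ) G with hLdef
  obtain ⟨ρ, hρ, hle⟩ := L.exists_le_of_forall_norm_sub_lt (isClosed_limitSubgroup _ _)
  by_contra hcon
  rw [← Ultrafilter.eventually_not] at hcon
  have key : ∀ n, ∃ h : ι → ℝ, (¬ G n ≤ L → h ∈ G n ∧ ∀ x ∈ L, ρ ≤ ‖h - x‖) ∧
      h ∈ Set.Icc (0 : ι → ℝ) 1 := by
    intro n
    by_cases hn : G n ≤ L
    · exact ⟨0, fun h => absurd hn h, le_rfl, zero_le_one⟩
    · have h1 : ¬ ∀ h ∈ G n, ∃ x ∈ L, ‖h - x‖ < ρ := fun h => hn (hle _ h)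
      push Not at h1
      obtain ⟨h, hh, hx⟩ := h1
      have hz : ∀ m, (fun i => ((⌊h i⌋ : ℤ) : ℝ)) ∈ G m := fun m => hG m fun i => ⌊h i⌋
      refine ⟨h - fun i => ((⌊h i⌋ : ℤ) : ℝ), fun _ => ⟨(G n).sub_mem hh (hz n), fun x hxL => ?_⟩,
        fun i => Int.fract_nonneg (h i), fun i => (Int.fract_lt_one (h i)).le⟩
      rw [sub_sub]
      exact hx _ (L.add_mem (mem_limitSubgroup_of_forall hz) hxL)
  choose h hh hI using key
  obtain ⟨a, -, ha⟩ := isCompact_Icc.ultrafilter_le_nhds (l.map h)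
    (le_principal_iff.2 (Filter.mem_map.2 (Filter.univ_mem' hI)))
  have ha' : Tendsto h l (𝓝 a) := ha
  have hclose : ∀ δ : ℝ, 0 < δ → ∀ᶠ n in (l : Filter ℕ), ‖h n - a‖ < δ := fun δ hδ => by
    filter_upwards [Metric.tendsto_nhds.1 ha' δ hδ] with n hn
    rwa [← dist_eq_norm]
  have haL : a ∈ L := fun δ hδ => by
    filter_upwards [hclose δ hδ, hcon] with n h1 h2
    exact ⟨h n, (hh n h2).1, h1⟩
  obtain ⟨n, h1, h2⟩ := ((hclose ρ hρ).and hcon).exists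
  exact absurd h1 (not_lt.2 ((hh n h2).2 a haL))

/-- The additive subgroup of all vectors which agree with an element of `G` on the coordinates
in `s`. -/
def freeOff {ι : Type*} (s : Set ι) (G : AddSubgroup (ι → ℝ)) : AddSubgroup (ι → ℝ) where
  carrier := {x | ∃ y ∈ G, ∀ i ∈ s, x i = y i}
  add_mem' := by
    rintro x x' ⟨y, hy, h⟩ ⟨y', hy', h'⟩
    exact ⟨y + y', G.add_mem hy hy', fun i hi => by simp [h i hi, h' i hi]⟩
  zero_mem' := ⟨0, G.zero_mem, fun i _ => rfl⟩
  neg_mem' := by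
    rintro x ⟨y, hy, h⟩
    exact ⟨-y, G.neg_mem hy, fun i hi => by simp [h i hi]⟩

open Filter Topology in
theorem limitSubgroup_freeOff_avoids {ι : Type*} [Fintype ι] {l : Filter ℕ} [l.NeBot]
    {α : ℕ → ι → ℝ} {β : ι → ℝ} {G : ℕ → AddSubgroup (ι → ℝ)} (hα0 : ∀ n i, 0 ≤ α n i)
    (hG : ∀ n (z : ι → ℤ), (fun i => (z i : ℝ)) ∈ G n) (hαβ : Tendsto α l (𝓝 β))
    (havoid : ∀ n, ∀ x ∈ G n, (∀ i, 0 < x i) → ¬ ∑ i, α n i * x i < 1)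
    {x : ι → ℝ} (hx : x ∈ limitSubgroup l fun n => freeOff {i | β i ≠ 0} (G n))
    (hpos : ∀ i, 0 < x i) : ¬ ∑ i, β i * x i < 1 := by
  classical
  intro hlt
  have hsum : ∑ i, β i * (if β i ≠ 0 then x i + 0 else 1) = ∑ i, β i * x i := by
    refine Finset.sum_congr rfl fun i _ => ?_
    by_cases h : β i = 0 <;> simp [h]
  have hcont : Tendsto (fun ρ : ℝ => ∑ i, β i * (if β i ≠ 0 then x i + ρ else 1)) (𝓝[>] 0)
      (𝓝 (∑ i, β i * x i)) := by
    rw [← hsum]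
    refine tendsto_nhdsWithin_of_tendsto_nhds (Continuous.tendsto ?_ 0)
    refine continuous_finsetSum _ fun i _ => continuous_const.mul ?_
    split_ifs <;> fun_prop
  have hsmall : ∀ᶠ ρ : ℝ in 𝓝[>] 0, ∀ i, ρ < x i :=
    eventually_all.2 fun i => eventually_nhdsWithin_of_eventually_nhds (eventually_lt_nhds (hpos i))
  obtain ⟨ρ, ⟨hρ1, hρ2⟩, hρ⟩ := ((hcont.eventually_lt_const hlt).and hsmall).and
    self_mem_nhdsWithin |>.exists
  have hρ0 : (0 : ℝ) < ρ := hρ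
  have hcost : Tendsto (fun n => ∑ i, α n i * (if β i ≠ 0 then x i + ρ else 1)) l
      (𝓝 (∑ i, β i * (if β i ≠ 0 then x i + ρ else 1))) :=
    tendsto_finsetSum _ fun i _ => (tendsto_pi_nhds.1 hαβ i).mul_const _
  obtain ⟨n, hn1, y, ⟨w, hw, hyw⟩, hyx⟩ :=
    ((hcost.eventually_lt_const hρ1).and (hx ρ hρ0)).exists
  have hz := hG n fun i => if β i ≠ 0 then 0 else 1 - ⌈w i⌉
  have hcoord : ∀ i, β i ≠ 0 → |w i - x i| < ρ := fun i hi => by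
    rw [← hyw i hi, ← Pi.sub_apply, ← Real.norm_eq_abs]
    exact (norm_le_pi_norm _ i).trans_lt hyx
  refine havoid n _ ((G n).add_mem hw hz) (fun i => ?_) (lt_of_le_of_lt ?_ hn1)
  · by_cases hi : β i = 0
    · have := Int.ceil_lt_add_one (w i)
      simp [hi]
      linarith
    · have := abs_lt.1 (hcoord i hi)
      have := hρ2 i
      simp [hi]
      linarith
  · refine Finset.sum_le_sum fun i _ => mul_le_mul_of_nonneg_left ?_ (hα0 n i)
    by_cases hi : β i = 0
    · have := Int.le_ceil (w i)
      simp [hi]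
      linarith
    · have := abs_lt.1 (hcoord i hi)
      simp [hi]
      linarith

open Filter Topology in
/-- Uniform lifting: if a subgroup of `ℝ^ι` containing `ℤ^ι` avoids an open corner simplex with
weights in an ACC set, then so does the subgroup enlarged by the line through a short element. -/
theorem exists_short_avoids {A : Set ℝ} (hA : A ⊆ Set.Ioi 0) (hACC : ACCSet A) (ι : Type)
    [Fintype ι] : ∃ ε : ℝ, 0 < ε ∧ ∀ (α : ι → ℝ) (G : AddSubgroup (ι → ℝ)),
      (∀ i, α i ∈ A ∨ α i = 0) → (∀ z : ι → ℤ, (fun i => (z i : ℝ)) ∈ G) →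
      (∀ x ∈ G, (∀ i, 0 < x i) → ¬ ∑ i, α i * x i < 1) →
      ∀ u ∈ G, ∑ i, α i * |u i| < ε → ∀ x ∈ G, ∀ c : ℝ, (∀ i, 0 < x i + c * u i) →
        ¬ ∑ i, α i * (x i + c * u i) < 1 := by
  classical
  by_contra! hcon
  have hcon' := fun n : ℕ => hcon (1 / ((n : ℝ) + 1)) (by positivity)
  choose α G hαA hG havoid u hu hushort x hx c hpos hlt using hcon'
  have hα0 : ∀ n i, 0 ≤ α n i := fun n i => by
    rcases hαA n i with h | h
    · exact (hA h).le
    · exact h.ge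
  obtain ⟨M, hM⟩ := hACC.bddAbove
  set l : Ultrafilter ℕ := hyperfilter ℕ with hl
  have hle : (l : Filter ℕ) ≤ atTop := by
    rw [hl, ← Nat.cofinite_eq_atTop]
    exact hyperfilter_le_cofinite
  have hIcc : ∀ n, α n ∈ Set.Icc (0 : ι → ℝ) (fun _ => max M 0) := fun n =>
    ⟨hα0 n, fun i => by
      rcases hαA n i with h | h
      · exact (hM h).trans (le_max_left _ _)
      · rw [h]; exact le_max_right _ _⟩
  obtain ⟨β, -, hβ⟩ := isCompact_Icc.ultrafilter_le_nhds (l.map α)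
    (le_principal_iff.2 (Filter.mem_map.2 (Filter.univ_mem' hIcc)))
  have hαβ : Tendsto α l (𝓝 β) := hβ
  have hβi := tendsto_pi_nhds.1 hαβ
  have hβ0 : ∀ i, 0 ≤ β i := fun i => ge_of_tendsto (hβi i) (Eventually.of_forall fun n => hα0 n i)
  have hβα : ∀ᶠ n in (l : Filter ℕ), ∀ i, β i ≤ α n i := eventually_all.2 fun i =>
    hACC.eventually_le (fun n => hαA n i) (fun n => hα0 n i) (hβi i)
  set G' : ℕ → AddSubgroup (ι → ℝ) := fun n => freeOff {i | β i ≠ 0} (G n) with hG'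
  have hGG' : ∀ n, ∀ y ∈ G n, y ∈ G' n := fun n y hy => ⟨y, hy, fun i _ => rfl⟩
  set L := limitSubgroup (l : Filter ℕ) G' with hL
  have hG'L := eventually_le_limitSubgroup l G' fun n z => hGG' n _ (hG n z)
  obtain ⟨ρ, hρ, hdisc⟩ := L.exists_norm_lt_imp_smul_mem (isClosed_limitSubgroup _ _)
  have hfree : ∀ y : ι → ℝ, (∀ i, β i ≠ 0 → y i = 0) → y ∈ L := fun y hy =>
    mem_limitSubgroup_of_forall fun n => ⟨0, (G n).zero_mem, fun i hi => hy i hi⟩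
  set u' : ℕ → ι → ℝ := fun n i => if β i ≠ 0 then u n i else 0 with hu'
  have hu'G : ∀ n, u' n ∈ G' n := fun n => ⟨u n, hu n, fun i (hi : β i ≠ 0) => by simp [hu', hi]⟩
  have hsmall : ∀ᶠ n : ℕ in (l : Filter ℕ), ∀ i, β i ≠ 0 → 1 / ((n : ℝ) + 1) < ρ * β i := by
    refine eventually_all.2 fun i => ?_
    by_cases hi : β i = 0
    · simp [hi]
    · have : 0 < ρ * β i := mul_pos hρ (lt_of_le_of_ne (hβ0 i) (Ne.symm hi))
      filter_upwards [hle (tendsto_one_div_add_atTop_nhds_zero_nat.eventually_lt_const this)]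
        with n hn _ using hn
  obtain ⟨n, ⟨hn1, hn2⟩, hn3⟩ := ((hG'L.and hsmall).and hβα).exists
  have hu'n : ‖u' n‖ < ρ := by
    rw [pi_norm_lt_iff hρ]
    intro i
    by_cases hi : β i = 0
    · simpa [hu', hi]
    · have hb : 0 < β i := lt_of_le_of_ne (hβ0 i) (Ne.symm hi)
      have h1 : α n i * |u n i| ≤ ∑ i, α n i * |u n i| :=
        Finset.single_le_sum (f := fun i => α n i * |u n i|)
          (fun j _ => mul_nonneg (hα0 n j) (abs_nonneg _)) (Finset.mem_univ i)
      have h2 := mul_le_mul_of_nonneg_right (hn3 i) (abs_nonneg (u n i))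
      have h3 : β i * |u n i| < β i * ρ := by
        linarith [hn2 i hi, hushort n]
      simpa [hu', hi] using lt_of_mul_lt_mul_left h3 hb.le
  have hmem : x n + c n • u n ∈ L := by
    have e : x n + c n • u n = x n + c n • u' n + c n • (u n - u' n) := by
      rw [smul_sub]; abel
    rw [e]
    refine L.add_mem (L.add_mem (hn1 (hGG' n _ (hx n))) (hdisc _ (hn1 (hu'G n)) hu'n _))
      (hfree _ fun i hi => ?_)
    simp [hu', hi]
  refine limitSubgroup_freeOff_avoids hα0 hG hαβ
    (fun n x hx h => not_lt.2 (havoid n x hx h)) hmem (hpos n) (lt_of_le_of_lt ?_ (hlt n))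
  exact Finset.sum_le_sum fun i _ => mul_le_mul_of_nonneg_right (hn3 i) (hpos n i).le

theorem exists_short_avoids_of_card_le {A : Set ℝ} (hA : A ⊆ Set.Ioi 0) (hACC : ACCSet A)
    (R : ℕ) : ∃ ε : ℝ, 0 < ε ∧ ∀ r ≤ R, ∀ (α : Fin r → ℝ) (G : AddSubgroup (Fin r → ℝ)),
      (∀ i, α i ∈ A ∨ α i = 0) → (∀ z : Fin r → ℤ, (fun i => (z i : ℝ)) ∈ G) →
      (∀ x ∈ G, (∀ i, 0 < x i) → ¬ ∑ i, α i * x i < 1) →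
      ∀ u ∈ G, ∑ i, α i * |u i| < ε → ∀ x ∈ G, ∀ c : ℝ, (∀ i, 0 < x i + c * u i) →
        ¬ ∑ i, α i * (x i + c * u i) < 1 := by
  choose ε hε h using fun r : ℕ => exists_short_avoids hA hACC (Fin r)
  obtain ⟨m, hm, hmin⟩ := Finset.exists_min_image (Finset.range (R + 1)) ε ⟨0, by simp⟩
  refine ⟨ε m, hε m, fun r hr α G h1 h2 h3 u hu hs => h r α G h1 h2 h3 u hu (hs.trans_le ?_)⟩
  exact hmin r (Finset.mem_range.2 (Nat.lt_succ_of_le hr))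

/-- Carathéodory's theorem for cones. -/
theorem exists_nonneg_sum_smul_eq_card_le_finrank {ι E : Type*} [Fintype ι] [DecidableEq ι]
    [AddCommGroup E] [Module ℝ E] [FiniteDimensional ℝ E] (g : ι → E) (w : ι → ℝ)
    (hw : ∀ i, 0 ≤ w i) :
    ∃ w' : ι → ℝ, (∀ i, 0 ≤ w' i) ∧ ∑ i, w' i • g i = ∑ i, w i • g i ∧
      (Finset.univ.filter fun i => w' i ≠ 0).card ≤ Module.finrank ℝ E := by
  induction hk : (Finset.univ.filter fun i => w i ≠ 0).card using Nat.strong_induction_on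
    generalizing w with
  | _ k ih =>
  subst hk
  set S := Finset.univ.filter fun i => w i ≠ 0 with hS
  by_cases hcard : S.card ≤ Module.finrank ℝ E
  · exact ⟨w, hw, rfl, hcard⟩
  have hdep : ¬ LinearIndependent ℝ fun i : S => g i := fun hli => by
    have := hli.fintype_card_le_finrank
    rw [Fintype.card_coe] at this
    exact hcard this
  obtain ⟨c, hc, ⟨i₀, hi₀⟩, hcpos⟩ : ∃ c : S → ℝ, ∑ i, c i • g i = 0 ∧ (∃ i, c i ≠ 0) ∧
      ∃ i, 0 < c i := by
    obtain ⟨c, hc, i, hi⟩ := Fintype.not_linearIndependent_iff.1 hdep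
    rcases lt_or_gt_of_ne hi with h | h
    · exact ⟨-c, by
        simpa only [Pi.neg_apply, neg_smul, Finset.sum_neg_distrib, neg_eq_zero] using hc,
        ⟨i, by simpa using hi⟩, i, by simpa using h⟩
    · exact ⟨c, hc, ⟨i, hi⟩, i, h⟩
  obtain ⟨j₀, hj₀⟩ := hcpos
  obtain ⟨j, hj, hmin⟩ := Finset.exists_min_image (Finset.univ.filter fun i : S => 0 < c i)
    (fun i => w i / c i) ⟨j₀, by simpa using hj₀⟩
  have hcj : 0 < c j := by simpa using hj
  set t := w j / c j with ht
  have ht0 : 0 ≤ t := div_nonneg (hw j) hcj.le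
  set C : ι → ℝ := fun i => if h : i ∈ S then c ⟨i, h⟩ else 0 with hC
  have hCS : ∀ i : S, C i = c i := fun i => by simp [hC]
  have hCn : ∀ i, i ∉ S → C i = 0 := fun i hi => by simp only [hC, dif_neg hi]
  have hCsum : ∑ i, C i • g i = 0 := by
    rw [← hc, ← Finset.sum_subset (Finset.subset_univ S)
      (fun i _ hi => by rw [hCn i hi, zero_smul]), ← Finset.sum_coe_sort]
    exact Finset.sum_congr rfl fun i _ => by rw [hCS]
  have hw1 : ∀ i, 0 ≤ w i - t * C i := by
    intro i
    by_cases hi : i ∈ S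
    · rw [hCS ⟨i, hi⟩]
      rcases le_or_gt (c ⟨i, hi⟩) 0 with h | h
      · nlinarith [hw i]
      · have := hmin ⟨i, hi⟩ (by simpa using h)
        rw [le_div_iff₀ h] at this
        linarith
    · rw [hCn i hi, mul_zero, sub_zero]
      exact hw i
  obtain ⟨w', h1, h2, h3⟩ := ih _ (Finset.card_lt_card (t := S)
    (s := Finset.univ.filter fun i => w i - t * C i ≠ 0) (by
      refine ⟨fun i hi => ?_, fun hsub => ?_⟩
      · by_contra hiS
        have hwi : w i = 0 := by simpa [hS] using hiS
        simp [hwi, hCn i hiS] at hi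
      · have := hsub j.2
        rw [Finset.mem_filter, hCS, ht, div_mul_cancel₀ _ hcj.ne'] at this
        exact this.2 (sub_self _))) (fun i => w i - t * C i) hw1 rfl
  refine ⟨w', h1, h2.trans ?_, h3⟩
  simp only [sub_smul, mul_smul, Finset.sum_sub_distrib, ← Finset.smul_sum, hCsum, smul_zero,
    sub_zero]

theorem exists_nonneg_sum_smul_eq_cost_eq {d n : ℕ} (e : Fin n → Fin d → ℝ) (α w : Fin n → ℝ)
    (hw : ∀ i, 0 ≤ w i) :
    ∃ w' : Fin n → ℝ, (∀ i, 0 ≤ w' i) ∧ ∑ i, w' i • e i = ∑ i, w i • e i ∧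
      ∑ i, α i * w' i = ∑ i, α i * w i ∧
      (Finset.univ.filter fun i => w' i ≠ 0).card ≤ d + 1 := by
  obtain ⟨w', h1, h2, h3⟩ :=
    exists_nonneg_sum_smul_eq_card_le_finrank (fun i => (e i, α i)) w hw
  have h4 := congrArg Prod.fst h2
  have h5 := congrArg Prod.snd h2
  simp only [Prod.fst_sum, Prod.snd_sum, Prod.smul_mk, smul_eq_mul] at h4 h5
  refine ⟨w', h1, h4, by simpa only [mul_comm] using h5, h3.trans (by simp)⟩

theorem sum_eq_sum_equiv {n r : ℕ} {S : Finset (Fin n)} (σ : Fin r ≃ S) {M : Type*}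
    [AddCommMonoid M] (f : Fin n → M) (hf : ∀ i, i ∉ S → f i = 0) :
    ∑ i, f i = ∑ j, f (σ j) := by
  rw [σ.sum_comp (fun i : S => f i), Finset.sum_coe_sort]
  exact (Finset.sum_subset (Finset.subset_univ S) fun i _ hi => hf i hi).symm

open Filter Topology in
theorem avoids_of_support_subset {d n : ℕ} {e : Fin n → Fin d → ℝ} {α : Fin n → ℝ}
    {Γ : AddSubgroup (Fin d → ℝ)}
    (havoid : ∀ w : Fin n → ℝ, (∀ i, 0 < w i) → ∑ i, α i * w i < 1 → ∑ i, w i • e i ∉ Γ)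
    {S : Finset (Fin n)} {q : Fin n → ℝ} (hq : ∑ i, q i • e i = ∑ i, e i)
    (hqS : ∀ i, i ∉ S → q i = 0) {w : Fin n → ℝ} (hw : ∀ i ∈ S, 0 < w i)
    (hwS : ∀ i, i ∉ S → w i = 0) (hlt : ∑ i, α i * w i < 1) : ∑ i, w i • e i ∉ Γ := by
  have h1 : ∀ᶠ η : ℝ in 𝓝[>] 0, ∀ i, i ∈ S → 0 < w i + η * (1 - q i) := by
    refine eventually_all.2 fun i => ?_
    by_cases hi : i ∈ S
    · have : Tendsto (fun η : ℝ => w i + η * (1 - q i)) (𝓝[>] 0) (𝓝 (w i + 0 * (1 - q i))) :=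
        tendsto_nhdsWithin_of_tendsto_nhds (Continuous.tendsto (by fun_prop) 0)
      rw [zero_mul, add_zero] at this
      filter_upwards [this.eventually_const_lt (hw i hi)] with η h _ using h
    · simp [hi]
  have h2 : Tendsto (fun η : ℝ => ∑ i, α i * (w i + η * (1 - q i))) (𝓝[>] 0)
      (𝓝 (∑ i, α i * (w i + 0 * (1 - q i)))) :=
    tendsto_nhdsWithin_of_tendsto_nhds (Continuous.tendsto (by fun_prop) 0)
  simp only [zero_mul, add_zero] at h2
  obtain ⟨η, ⟨hη1, hη2⟩, hη⟩ :=
    ((h1.and (h2.eventually_lt_const hlt)).and self_mem_nhdsWithin).exists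
  have hη0 : (0 : ℝ) < η := hη
  have := havoid (fun i => w i + η * (1 - q i)) (fun i => ?_) hη2
  · convert this using 2
    simp only [add_smul, mul_smul, sub_smul, one_smul, Finset.sum_add_distrib,
      ← Finset.smul_sum, Finset.sum_sub_distrib, hq, sub_self, smul_zero, add_zero]
  · by_cases hi : i ∈ S
    · exact hη1 i hi
    · simpa [hwS i hi, hqS i hi] using hη0

open Filter Topology in
theorem exists_short_adjoin_avoids (d : ℕ) {A : Set ℝ} (hA : A ⊆ Set.Ioi 0) (hACC : ACCSet A) :
    ∃ ε : ℝ, 0 < ε ∧ ∀ (n : ℕ) (e : Fin n → Fin d → ℝ) (α : Fin n → ℝ)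
      (Γ : AddSubgroup (Fin d → ℝ)), (∀ i, e i ∈ Γ) → (∀ i, α i ∈ A ∨ α i = 0) →
      (∀ w : Fin n → ℝ, (∀ i, 0 < w i) → ∑ i, α i * w i < 1 → ∑ i, w i • e i ∉ Γ) →
      ∀ a b : Fin n → ℝ, (∀ i, 0 ≤ a i) → (∀ i, 0 ≤ b i) → ∑ i, α i * a i < ε →
        ∑ i, α i * b i < ε → (∑ i, b i • e i - ∑ i, a i • e i) ∈ Γ →
      ∀ w : Fin n → ℝ, (∀ i, 0 < w i) → ∑ i, α i * w i < 1 → ∀ c : ℝ,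
        ∑ i, w i • e i + c • (∑ i, b i • e i - ∑ i, a i • e i) ∉ Γ := by
  obtain ⟨ε, hε, hcore⟩ := exists_short_avoids_of_card_le hA hACC (4 * (d + 1))
  refine ⟨ε / 2, by positivity, ?_⟩
  intro n e α Γ heΓ hαA havoid a₀ b₀ ha₀ hb₀ hac₀ hbc₀ hmem w hw hwc c hcon
  have hα0 : ∀ i, 0 ≤ α i := fun i => by
    rcases hαA i with h | h
    · exact (hA h).le
    · exact h.ge
  obtain ⟨a, ha, hae, hac, haS⟩ := exists_nonneg_sum_smul_eq_cost_eq e α a₀ ha₀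
  obtain ⟨b, hb, hbe, hbc, hbS⟩ := exists_nonneg_sum_smul_eq_cost_eq e α b₀ hb₀
  obtain ⟨q, -, hqe, -, hqS⟩ := exists_nonneg_sum_smul_eq_cost_eq e α (fun _ => 1)
    (fun _ => zero_le_one)
  simp only [one_smul] at hqe
  rw [← hae, ← hbe] at hmem hcon
  rw [← hac] at hac₀
  rw [← hbc] at hbc₀
  set T := (Finset.univ.filter fun i => a i ≠ 0) ∪ (Finset.univ.filter fun i => b i ≠ 0) ∪
    (Finset.univ.filter fun i => q i ≠ 0) with hT
  obtain ⟨η, hη, hη0⟩ : ∃ η : ℝ, (∀ i, η < w i) ∧ 0 < η := by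
    have h1 : ∀ᶠ η : ℝ in 𝓝[>] 0, ∀ i, η < w i :=
      eventually_all.2 fun i => eventually_nhdsWithin_of_eventually_nhds (eventually_lt_nhds (hw i))
    exact (h1.and self_mem_nhdsWithin).exists
  obtain ⟨y, hy, hye, hyc, hyS⟩ := exists_nonneg_sum_smul_eq_cost_eq e α
    (fun i => w i - if i ∈ T then η else 0) (fun i => by
      split_ifs
      · linarith [hη i]
      · linarith [hw i])
  set S := T ∪ (Finset.univ.filter fun i => y i ≠ 0) with hS
  have hScard : S.card ≤ 4 * (d + 1) := by
    have h1 := Finset.card_union_le T (Finset.univ.filter fun i => y i ≠ 0)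
    have h2 := Finset.card_union_le ((Finset.univ.filter fun i => a i ≠ 0) ∪
      (Finset.univ.filter fun i => b i ≠ 0)) (Finset.univ.filter fun i => q i ≠ 0)
    have h3 := Finset.card_union_le (Finset.univ.filter fun i => a i ≠ 0)
      (Finset.univ.filter fun i => b i ≠ 0)
    rw [← hT] at h2
    rw [← hS] at h1
    omega
  have hSn : ∀ i, i ∉ S → a i = 0 ∧ b i = 0 ∧ q i = 0 ∧ i ∉ T ∧ y i = 0 := by
    intro i hi
    have hi' := hi
    simp only [hS, hT, Finset.mem_union, Finset.mem_filter, Finset.mem_univ, true_and, not_or,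
      not_not] at hi' ⊢
    tauto
  set y' : Fin n → ℝ := fun i => y i + if i ∈ T then η else 0 with hy'
  have hy'e : ∑ i, y' i • e i = ∑ i, w i • e i := by
    simp only [hy', add_smul, Finset.sum_add_distrib, hye, sub_smul, Finset.sum_sub_distrib,
      sub_add_cancel]
  have hy'c : ∑ i, α i * y' i = ∑ i, α i * w i := by
    simp only [hy', mul_add, Finset.sum_add_distrib, hyc, mul_sub, Finset.sum_sub_distrib,
      sub_add_cancel]
  have hy'pos : ∀ i ∈ S, 0 < y' i := by
    intro i hi
    by_cases hiT : i ∈ T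
    · simp only [hy', hiT, if_true]
      linarith [hy i]
    · have : y i ≠ 0 := by simpa [hS, hiT] using hi
      simpa [hy', hiT] using lt_of_le_of_ne (hy i) this.symm
  have hy'n : ∀ i, i ∉ S → y' i = 0 := fun i hi => by
    obtain ⟨-, -, -, h4, h5⟩ := hSn i hi
    simp [hy', h4, h5]
  let σ : Fin S.card ≃ S := S.equivFin.symm
  let Φ : (Fin S.card → ℝ) →ₗ[ℝ] (Fin d → ℝ) :=
    Fintype.linearCombination ℝ fun j => e (σ j)
  have hΦ : ∀ x, Φ x = ∑ j, x j • e (σ j) := fun x => Fintype.linearCombination_apply _ _ _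
  have hΦres : ∀ x : Fin n → ℝ, (∀ i, i ∉ S → x i = 0) →
      Φ (fun j => x (σ j)) = ∑ i, x i • e i := fun x hx => by
    rw [hΦ, sum_eq_sum_equiv σ (fun i => x i • e i) fun i hi => by rw [hx i hi, zero_smul]]
  have hcres : ∀ x : Fin n → ℝ, (∀ i, i ∉ S → x i = 0) →
      ∑ j, α (σ j) * x (σ j) = ∑ i, α i * x i := fun x hx => by
    rw [sum_eq_sum_equiv σ (fun i => α i * x i) fun i hi => by rw [hx i hi, mul_zero]]
  set u : Fin S.card → ℝ := fun j => b (σ j) - a (σ j) with hu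
  have hΦu : Φ u = ∑ i, b i • e i - ∑ i, a i • e i := by
    rw [← hΦres b fun i hi => (hSn i hi).2.1, ← hΦres a fun i hi => (hSn i hi).1, ← map_sub]
    rfl
  have hΦy : Φ (fun j => y' (σ j)) = ∑ i, w i • e i := by rw [hΦres y' hy'n, hy'e]
  refine hcore S.card hScard (fun j => α (σ j)) (Γ.comap Φ.toAddMonoidHom) (fun j => hαA _)
    (fun z => ?_) (fun x hx hpos hlt => ?_) u ?_ ?_ ((fun j => y' (σ j)) + c • u) ?_ (-c)
    (fun j => ?_) ?_
  · change Φ _ ∈ Γ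
    rw [hΦ]
    refine Γ.sum_mem fun j _ => ?_
    rw [Int.cast_smul_eq_zsmul]
    exact Γ.zsmul_mem (heΓ _) _
  · set X : Fin n → ℝ := fun i => if h : i ∈ S then x (σ.symm ⟨i, h⟩) else 0 with hX
    have hXn : ∀ i, i ∉ S → X i = 0 := fun i hi => by simp only [hX, dif_neg hi]
    have hXσ : ∀ j, X (σ j) = x j := fun j => by simp [hX]
    have hxX : x = fun j => X (σ j) := funext fun j => (hXσ j).symm
    refine avoids_of_support_subset havoid hqe (fun i hi => (hSn i hi).2.2.1) (w := X)
      (fun i hi => ?_) hXn ?_ ?_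
    · simpa only [hX, dif_pos hi] using hpos _
    · rw [← hcres X hXn]
      simpa only [hXσ] using hlt
    · rw [← hΦres X hXn, ← hxX]
      exact hx
  · change Φ u ∈ Γ
    rwa [hΦu]
  · have : ∑ j, α (σ j) * |u j| ≤ ∑ j, α (σ j) * b (σ j) + ∑ j, α (σ j) * a (σ j) := by
      rw [← Finset.sum_add_distrib]
      refine Finset.sum_le_sum fun j _ => ?_
      rw [← mul_add]
      refine mul_le_mul_of_nonneg_left ?_ (hα0 _)
      rw [hu, abs_le]
      constructor <;> linarith [ha (σ j), hb (σ j)]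
    rw [hcres a fun i hi => (hSn i hi).1, hcres b fun i hi => (hSn i hi).2.1] at this
    linarith
  · change Φ _ ∈ Γ
    rwa [map_add, map_smul, hΦy, hΦu]
  · simpa using hy'pos _ (σ j).2
  · simp only [Pi.add_apply, Pi.smul_apply, smul_eq_mul, neg_mul, add_neg_cancel_right]
    rwa [hcres y' hy'n, hy'c]

theorem mem_intLat_iff {d : ℕ} {x : Fin d → ℝ} : x ∈ intLat d ↔ ∃ z, toReal z = x := by
  refine ⟨fun h => ?_, ?_⟩
  · choose z hz using h
    exact ⟨z, funext fun i => (hz i).symm⟩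
  · rintro ⟨z, rfl⟩ i
    exact ⟨z i, rfl⟩

/-- The additive map `ℤ^d → ℝ^d`. -/
def toRealHom (d : ℕ) : (Fin d → ℤ) →+ (Fin d → ℝ) where
  toFun := toReal
  map_zero' := by ext; simp [toReal]
  map_add' x y := by ext; simp [toReal]

theorem range_toRealHom (d : ℕ) : ((toRealHom d).range : Set (Fin d → ℝ)) = intLat d :=
  Set.ext fun _ => mem_intLat_iff.symm

/-- The quotient of `ℝ^d` by a rational subspace, in coordinates adapted to the lattice. -/
theorem exists_lattice_quotient {d : ℕ} (W : Submodule ℝ (Fin d → ℝ))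
    (hW : W ≤ Submodule.span ℝ ((W : Set (Fin d → ℝ)) ∩ intLat d)) :
    ∃ (p : ℕ) (π : (Fin d → ℝ) →ₗ[ℝ] (Fin p → ℝ)), p ≤ d ∧ Function.Surjective π ∧
      π '' intLat d = intLat p ∧ LinearMap.ker π = W := by
  let ψ : (Fin d → ℤ) →ₗ[ℤ] (Fin d → ℝ) := (toRealHom d).toIntLinearMap
  let N : Submodule ℤ (Fin d → ℤ) := (W.restrictScalars ℤ).comap ψ
  have hN : ∀ z, z ∈ N ↔ toReal z ∈ W := fun z => Iff.rfl
  have : Module.IsTorsionFree ℤ ((Fin d → ℤ) ⧸ N) := by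
    rw [Module.isTorsionFree_iff_smul_eq_zero]
    intro k m hm
    induction m using Submodule.Quotient.induction_on with
    | _ z =>
    rw [or_iff_not_imp_left]
    intro hk
    rw [← Submodule.Quotient.mk_smul, Submodule.Quotient.mk_eq_zero] at hm
    rw [Submodule.Quotient.mk_eq_zero, hN]
    have h1 : (k : ℝ) • toReal z ∈ W := by
      have : toReal (k • z) = (k : ℝ) • toReal z := by ext; simp [toReal]
      rw [← this]
      exact hm
    exact (Submodule.smul_mem_iff W (Int.cast_ne_zero.2 hk)).1 h1
  let B := Module.finBasis ℤ ((Fin d → ℤ) ⧸ N)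
  set p := Module.finrank ℤ ((Fin d → ℤ) ⧸ N) with hp
  let φ : (Fin d → ℤ) →ₗ[ℤ] (Fin p → ℤ) := B.equivFun.toLinearMap ∘ₗ N.mkQ
  have hφs : Function.Surjective φ := B.equivFun.surjective.comp N.mkQ_surjective
  have hφk : ∀ z, φ z = 0 ↔ toReal z ∈ W := fun z => by
    rw [← hN]
    simp [φ]
  let π : (Fin d → ℝ) →ₗ[ℝ] (Fin p → ℝ) :=
    Fintype.linearCombination ℝ fun j => toReal (φ (Pi.single j 1))
  have hπ : ∀ x, π x = ∑ j, x j • toReal (φ (Pi.single j 1)) := fun x =>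
    Fintype.linearCombination_apply _ _ _
  have hsum : ∀ {m : ℕ} (z : Fin m → ℤ), z = ∑ j, z j • Pi.single j (1 : ℤ) := fun z => by
    ext
    simp [Pi.single_apply]
  have hπφ : ∀ z, π (toReal z) = toReal (φ z) := fun z => by
    have h1 : φ z = ∑ j, z j • φ (Pi.single j 1) := by
      conv_lhs => rw [hsum z]
      simp only [map_sum, map_smul]
    rw [hπ, h1]
    ext k
    simp [toReal]
  choose g hg using fun k : Fin p => hφs (Pi.single k 1)
  have hsect : ∀ x : Fin d → ℝ, x - ∑ k, π x k • toReal (g k) ∈ W := by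
    intro x
    have h1 : x - ∑ k, π x k • toReal (g k) = ∑ j, x j • toReal
        (Pi.single j (1 : ℤ) - ∑ k, φ (Pi.single j 1) k • g k) := by
      ext i
      simp only [hπ, toReal, Pi.sub_apply, Finset.sum_apply, Pi.smul_apply, smul_eq_mul,
        Int.cast_sub, Int.cast_sum, Int.cast_mul, mul_sub, Finset.sum_sub_distrib]
      congr 1
      · simp [Pi.single_apply]
      · simp only [Finset.sum_mul, Finset.mul_sum]
        rw [Finset.sum_comm]
        simp only [mul_assoc]
    rw [h1]
    refine W.sum_mem fun j _ => W.smul_mem _ ((hφk _).1 ?_)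
    simp only [map_sub, map_sum, map_smul, hg]
    rw [← hsum, sub_self]
  have hsurj : Function.Surjective π := fun y => by
    refine ⟨∑ k, y k • toReal (g k), ?_⟩
    simp only [map_sum, map_smul, hπφ, hg]
    ext i
    simp [toReal, Pi.single_apply]
  refine ⟨p, π, by simpa using LinearMap.finrank_le_finrank_of_surjective hsurj, hsurj, ?_, ?_⟩
  · ext y
    simp only [Set.mem_image, mem_intLat_iff]
    constructor
    · rintro ⟨_, ⟨z, rfl⟩, rfl⟩
      exact ⟨φ z, (hπφ z).symm⟩
    · rintro ⟨z, rfl⟩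
      obtain ⟨z', rfl⟩ := hφs z
      exact ⟨_, ⟨z', rfl⟩, hπφ z'⟩
  · refine le_antisymm (fun x hx => ?_) (hW.trans (Submodule.span_le.2 ?_))
    · have := hsect x
      rw [LinearMap.mem_ker] at hx
      simpa [hx] using this
    · rintro x ⟨hxW, hxl⟩
      obtain ⟨z, rfl⟩ := mem_intLat_iff.1 hxl
      rw [SetLike.mem_coe, LinearMap.mem_ker, hπφ, (hφk z).2 hxW]
      ext; simp [toReal]

/-- The set of nonnegative combinations of a family with total weighted cost at most `1`. -/
def costBody {ι E : Type*} [Fintype ι] [AddCommGroup E] [Module ℝ E] (α : ι → ℝ) (e : ι → E) :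
    Set E :=
  {x | ∃ w : ι → ℝ, (∀ i, 0 ≤ w i) ∧ ∑ i, α i * w i ≤ 1 ∧ ∑ i, w i • e i = x}

theorem convex_costBody {ι E : Type*} [Fintype ι] [AddCommGroup E] [Module ℝ E] (α : ι → ℝ)
    (e : ι → E) : Convex ℝ (costBody α e) := by
  rintro _ ⟨w, hw, hc, rfl⟩ _ ⟨w', hw', hc', rfl⟩ s t hs ht hst
  refine ⟨fun i => s * w i + t * w' i, fun i => ?_, ?_, ?_⟩
  · have := hw i
    have := hw' i
    positivity
  · have : ∑ i, α i * (s * w i + t * w' i) = s * ∑ i, α i * w i + t * ∑ i, α i * w' i := by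
      rw [Finset.mul_sum, Finset.mul_sum, ← Finset.sum_add_distrib]
      exact Finset.sum_congr rfl fun i _ => by ring
    rw [this]
    nlinarith
  · simp only [add_smul, mul_smul, Finset.sum_add_distrib, ← Finset.smul_sum]

theorem convexHull_add_cone_eq_costBody {ι E : Type*} [Fintype ι] [AddCommGroup E] [Module ℝ E]
    {a : ι → ℝ} (ha : ∀ i, 0 ≤ a i) (e : ι → E) :
    convexHull ℝ ({0} ∪ {x | ∃ i, 0 < a i ∧ x = (1 / a i) • e i}) +
      {x | ∃ c : ι → ℝ, (∀ i, 0 ≤ c i) ∧ (∀ i, a i ≠ 0 → c i = 0) ∧ x = ∑ i, c i • e i} =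
    costBody a e := by
  classical
  apply Set.Subset.antisymm
  · rintro _ ⟨x, hx, _, ⟨c, hc, hca, rfl⟩, rfl⟩
    have hsub : convexHull ℝ ({0} ∪ {x | ∃ i, 0 < a i ∧ x = (1 / a i) • e i}) ⊆
        costBody a e := by
      refine convexHull_min ?_ (convex_costBody a e)
      rintro x (rfl | ⟨i, hi, rfl⟩)
      · exact ⟨0, fun _ => le_rfl, by simp, by simp⟩
      · refine ⟨Pi.single i (1 / a i), fun j => ?_, ?_, ?_⟩
        · by_cases h : j = i
          · subst h; simp [hi.le]
          · simp [h]
        · simp [Pi.single_apply, hi.ne']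
        · simp [Pi.single_apply, ite_smul]
    obtain ⟨w, hw, hwc, rfl⟩ := hsub hx
    refine ⟨w + c, fun i => add_nonneg (hw i) (hc i), ?_, ?_⟩
    · have : ∀ i, a i * c i = 0 := fun i => by
        by_cases h : a i = 0
        · simp [h]
        · simp [hca i h]
      simpa [mul_add, Finset.sum_add_distrib, this] using hwc
    · simp [add_smul, Finset.sum_add_distrib]
  · rintro _ ⟨w, hw, hwc, rfl⟩
    refine ⟨∑ i, (a i * w i) • ((1 / a i) • e i), ?_,
      ∑ i, (if a i = 0 then w i else 0) • e i, ⟨_, fun i => ?_, fun i hi => ?_, rfl⟩, ?_⟩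
    · set H := convexHull ℝ ({0} ∪ {x | ∃ i, 0 < a i ∧ x = (1 / a i) • e i}) with hH
      have hconv : Convex ℝ H := convex_convexHull ℝ _
      have h0 : (0 : E) ∈ H := subset_convexHull ℝ _ (Or.inl rfl)
      have hz : ∀ i, (1 / a i) • e i ∈ H := fun i => by
        rcases (ha i).eq_or_lt with h | h
        · rwa [← h, div_zero, zero_smul]
        · exact subset_convexHull ℝ _ (Or.inr ⟨i, h, rfl⟩)
      have hpos : ∀ i, 0 ≤ a i * w i := fun i => mul_nonneg (ha i) (hw i)
      rcases (Finset.sum_nonneg fun i (_ : i ∈ Finset.univ) => hpos i).eq_or_lt with h | h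
      · have h1 := (Finset.sum_eq_zero_iff_of_nonneg fun i _ => hpos i).1 h.symm
        rw [Finset.sum_eq_zero fun i hi => by rw [h1 i hi, zero_smul]]
        exact h0
      · have h1 := hconv.centerMass_mem (t := Finset.univ) (fun i _ => hpos i) h fun i _ => hz i
        have h2 := hconv.smul_mem_of_zero_mem h0 h1 ⟨h.le, hwc⟩
        rwa [Finset.centerMass, smul_smul, mul_inv_cancel₀ h.ne', one_smul] at h2
    · split_ifs
      exacts [hw i, le_rfl]
    · simp [hi]
    · simp only
      rw [← Finset.sum_add_distrib]
      refine Finset.sum_congr rfl fun i _ => ?_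
      by_cases h : a i = 0
      · simp [h]
      · rw [smul_smul]
        simp only [h, if_false, zero_smul, add_zero]
        congr 1
        field_simp

theorem smul_costBody {ι E : Type*} [Fintype ι] [AddCommGroup E] [Module ℝ E] (a : ι → ℝ)
    (e : ι → E) {t : ℝ} (ht : 0 < t) : t • costBody a e = costBody (fun i => a i / t) e := by
  have ht' := ht.ne'
  ext x
  rw [Set.mem_smul_set]
  constructor
  · rintro ⟨_, ⟨w, hw, hc, rfl⟩, rfl⟩
    refine ⟨fun i => t * w i, fun i => mul_nonneg ht.le (hw i), ?_, ?_⟩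
    · convert hc using 2
      field_simp
    · simp only [mul_smul, Finset.smul_sum]
  · rintro ⟨w, hw, hc, rfl⟩
    refine ⟨_, ⟨fun i => w i / t, fun i => div_nonneg (hw i) ht.le, ?_, rfl⟩, ?_⟩
    · convert hc using 2
      field_simp
    · simp only [Finset.smul_sum, smul_smul, mul_div_cancel₀ _ ht']

theorem sum_smul_mem_interior_costBody {n d : ℕ} {α : Fin n → ℝ} {e : Fin n → Fin d → ℝ}
    (hspan : Submodule.span ℝ (Set.range e) = ⊤) {w : Fin n → ℝ} (hw : ∀ i, 0 < w i)
    (hlt : ∑ i, α i * w i < 1) : ∑ i, w i • e i ∈ interior (costBody α e) := by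
  have hsurj : Function.Surjective (Fintype.linearCombination ℝ e) := by
    rw [← LinearMap.range_eq_top, Fintype.range_linearCombination, hspan]
  have hopen := (Fintype.linearCombination ℝ e).isOpenMap_of_finiteDimensional hsurj
  have hO : IsOpen {w : Fin n → ℝ | (∀ i, 0 < w i) ∧ ∑ i, α i * w i < 1} := by
    simp only [Set.ofPred_and, Set.ofPred_forall]
    refine IsOpen.inter ?_ (isOpen_lt (by fun_prop) continuous_const)
    exact isOpen_iInter_of_finite fun i => isOpen_lt continuous_const (continuous_apply i)
  refine mem_interior.2 ⟨_, ?_, hopen _ hO, ⟨w, ⟨hw, hlt⟩, Fintype.linearCombination_apply _ _ _⟩⟩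
  rintro _ ⟨v, ⟨hv, hvlt⟩, rfl⟩
  exact ⟨v, fun i => (hv i).le, hvlt.le, (Fintype.linearCombination_apply _ _ _).symm⟩

open Filter Topology in
theorem exists_pos_of_mem_interior_image_costBody {n d p : ℕ} {α : Fin n → ℝ}
    {e : Fin n → Fin d → ℝ} (π : (Fin d → ℝ) →ₗ[ℝ] (Fin p → ℝ)) {y : Fin p → ℝ}
    (hy : y ∈ interior (π '' costBody α e)) :
    ∃ w : Fin n → ℝ, (∀ i, 0 < w i) ∧ ∑ i, α i * w i < 1 ∧ π (∑ i, w i • e i) = y := by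
  set q := π (∑ i, e i) with hq
  have hnhds : interior (π '' costBody α e) ∈ 𝓝 y := isOpen_interior.mem_nhds hy
  have h1 : Tendsto (fun s : ℝ => s • y) (𝓝[>] 1) (𝓝 ((1 : ℝ) • y)) :=
    tendsto_nhdsWithin_of_tendsto_nhds (Continuous.tendsto (by fun_prop) 1)
  rw [one_smul] at h1
  obtain ⟨s, hs1, hs⟩ := ((h1.eventually hnhds).and self_mem_nhdsWithin).exists
  have hs0 : (1 : ℝ) < s := hs
  have h2 : Tendsto (fun η : ℝ => s • y - η • q) (𝓝[>] 0) (𝓝 (s • y - (0 : ℝ) • q)) :=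
    tendsto_nhdsWithin_of_tendsto_nhds (Continuous.tendsto (by fun_prop) 0)
  rw [zero_smul, sub_zero] at h2
  have h3 : Tendsto (fun η : ℝ => 1 + η * ∑ i, α i) (𝓝[>] 0) (𝓝 (1 + 0 * ∑ i, α i)) :=
    tendsto_nhdsWithin_of_tendsto_nhds (Continuous.tendsto (by fun_prop) 0)
  rw [zero_mul, add_zero] at h3
  obtain ⟨η, ⟨hη1, hη2⟩, hη⟩ := ((h2.eventually (isOpen_interior.mem_nhds hs1)).and
    (h3.eventually_lt_const hs0)).and self_mem_nhdsWithin |>.exists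
  have hη0 : (0 : ℝ) < η := hη
  obtain ⟨_, ⟨w, hw, hc, rfl⟩, hwy⟩ := interior_subset hη1
  have hspos : 0 < s := by linarith
  refine ⟨fun i => s⁻¹ * (w i + η), fun i => ?_, ?_, ?_⟩
  · have := hw i
    positivity
  · have : ∑ i, α i * (s⁻¹ * (w i + η)) = s⁻¹ * (∑ i, α i * w i + η * ∑ i, α i) := by
      rw [Finset.mul_sum Finset.univ α η, ← Finset.sum_add_distrib, Finset.mul_sum]
      exact Finset.sum_congr rfl fun i _ => by ring
    rw [this, inv_mul_lt_iff₀ hspos]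
    linarith
  · simp only [mul_smul, add_smul, ← Finset.smul_sum, Finset.sum_add_distrib]
    rw [map_smul, map_add, map_smul, hwy, ← hq, sub_add_cancel, smul_smul,
      inv_mul_cancel₀ hspos.ne', one_smul]

theorem isBounded_image_costBody {n d p : ℕ} {α : Fin n → ℝ} {e : Fin n → Fin d → ℝ}
    (hα : ∀ i, 0 ≤ α i) (π : (Fin d → ℝ) →ₗ[ℝ] (Fin p → ℝ)) (h : ∀ i, α i = 0 → π (e i) = 0) :
    Bornology.IsBounded (π '' costBody α e) := by
  rw [isBounded_iff_forall_norm_le]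
  refine ⟨∑ i, (α i)⁻¹ * ‖π (e i)‖, ?_⟩
  rintro _ ⟨_, ⟨w, hw, hc, rfl⟩, rfl⟩
  rw [map_sum]
  refine (norm_sum_le _ _).trans (Finset.sum_le_sum fun i _ => ?_)
  rw [map_smul, norm_smul, Real.norm_of_nonneg (hw i)]
  rcases (hα i).eq_or_lt with h0 | h0
  · simp [h i h0.symm]
  · refine mul_le_mul_of_nonneg_right ?_ (norm_nonneg _)
    rw [← one_div, le_div_iff₀ h0, mul_comm]
    exact (Finset.single_le_sum (f := fun i => α i * w i)
      (fun j _ => mul_nonneg (hα j) (hw j)) (Finset.mem_univ i)).trans hc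

theorem image_interior_subset_interior_image {d p : ℕ} {π : (Fin d → ℝ) →ₗ[ℝ] (Fin p → ℝ)}
    (hπ : Function.Surjective π) (s : Set (Fin d → ℝ)) :
    π '' interior s ⊆ interior (π '' s) :=
  (π.isOpenMap_of_finiteDimensional hπ).image_interior_subset s

/-- The subgroup `ℤ^d + W` of `ℝ^d`. -/
def latticeAdd {d : ℕ} (W : Submodule ℝ (Fin d → ℝ)) : AddSubgroup (Fin d → ℝ) :=
  (toRealHom d).range ⊔ W.toAddSubgroup

theorem mem_latticeAdd {d : ℕ} {W : Submodule ℝ (Fin d → ℝ)} {x : Fin d → ℝ} :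
    x ∈ latticeAdd W ↔ ∃ z ∈ intLat d, ∃ y ∈ W, z + y = x := by
  rw [latticeAdd, AddSubgroup.mem_sup, ← range_toRealHom]
  rfl

theorem exists_projection_of_avoids {d n : ℕ} {e : Fin n → Fin d → ℝ} {α : Fin n → ℝ}
    (heL : ∀ i, e i ∈ intLat d) (hα : ∀ i, 0 ≤ α i) {ε : ℝ} (hε : 0 < ε)
    (hshort : ∀ Γ : AddSubgroup (Fin d → ℝ), (∀ i, e i ∈ Γ) →
      (∀ w : Fin n → ℝ, (∀ i, 0 < w i) → ∑ i, α i * w i < 1 → ∑ i, w i • e i ∉ Γ) →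
      ∀ a b : Fin n → ℝ, (∀ i, 0 ≤ a i) → (∀ i, 0 ≤ b i) → ∑ i, α i * a i < ε →
        ∑ i, α i * b i < ε → (∑ i, b i • e i - ∑ i, a i • e i) ∈ Γ →
      ∀ w : Fin n → ℝ, (∀ i, 0 < w i) → ∑ i, α i * w i < 1 → ∀ c : ℝ,
        ∑ i, w i • e i + c • (∑ i, b i • e i - ∑ i, a i • e i) ∉ Γ)
    (h0 : ∀ w : Fin n → ℝ, (∀ i, 0 < w i) → ∑ i, α i * w i < 1 → ∑ i, w i • e i ∉ intLat d) :
    ∃ p : ℕ, 1 ≤ p ∧ p ≤ d ∧ ∃ π : (Fin d → ℝ) →ₗ[ℝ] (Fin p → ℝ), Function.Surjective π ∧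
      π '' intLat d = intLat p ∧ Bornology.IsBounded (π '' costBody α e) ∧
      intLat p ∩ interior (π '' costBody α e) = ∅ ∧
      ∀ v ∈ intLat p, v ≠ 0 → ∀ s : ℝ, 0 < s → s < ε →
        v ∉ s • (π '' costBody α e - π '' costBody α e) := by
  obtain ⟨W, -, ⟨hWspan, hW⟩, hmax⟩ := exists_maximal_ge_of_wellFoundedGT
    (fun W : Submodule ℝ (Fin d → ℝ) =>
      W ≤ Submodule.span ℝ ((W : Set (Fin d → ℝ)) ∩ intLat d) ∧
      ∀ w : Fin n → ℝ, (∀ i, 0 < w i) → ∑ i, α i * w i < 1 → ∑ i, w i • e i ∉ latticeAdd W) ⊥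
    ⟨bot_le, fun w hw hlt hmem => by
      obtain ⟨z, hz, y, hy, hzy⟩ := mem_latticeAdd.1 hmem
      rw [Submodule.mem_bot] at hy
      rw [hy, add_zero] at hzy
      exact h0 w hw hlt (hzy ▸ hz)⟩
  obtain ⟨p, π, hpd, hsurj, hlat, hker⟩ := exists_lattice_quotient W hWspan
  have hnoshort : ∀ v ∈ intLat p, v ≠ 0 → ∀ s : ℝ, 0 < s → s < ε →
      v ∉ s • (π '' costBody α e - π '' costBody α e) := by
    intro v hv hv0 s hs hsε hmem
    rw [← hlat] at hv
    obtain ⟨z, hz, rfl⟩ := hv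
    obtain ⟨_, ⟨_, ⟨_, ⟨b, hb, hbc, rfl⟩, rfl⟩, _, ⟨_, ⟨a, ha, hac, rfl⟩, rfl⟩, rfl⟩, hzs⟩ := hmem
    simp only at hzs
    have hcost : ∀ x : Fin n → ℝ, ∑ i, α i * x i ≤ 1 → ∑ i, α i * (s * x i) < ε := fun x hx => by
      have : ∑ i, α i * (s * x i) = s * ∑ i, α i * x i := by
        rw [Finset.mul_sum]
        exact Finset.sum_congr rfl fun i _ => by ring
      rw [this]
      nlinarith
    set g := ∑ i, (s * b i) • e i - ∑ i, (s * a i) • e i with hg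
    have hgs : g = s • (∑ i, b i • e i - ∑ i, a i • e i) := by
      simp only [hg, smul_sub, Finset.smul_sum, smul_smul]
    have hzg : z - g ∈ W := by
      rw [← hker, LinearMap.mem_ker, map_sub, hgs, map_smul, map_sub, hzs, sub_self]
    have hgΓ : g ∈ latticeAdd W :=
      mem_latticeAdd.2 ⟨z, hz, -(z - g), W.neg_mem hzg, by abel⟩
    have key := hshort (latticeAdd W)
      (fun i => mem_latticeAdd.2 ⟨e i, heL i, 0, W.zero_mem, add_zero _⟩) hW
      (fun i => s * a i) (fun i => s * b i) (fun i => mul_nonneg hs.le (ha i))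
      (fun i => mul_nonneg hs.le (hb i)) (hcost a hac) (hcost b hbc) hgΓ
    have hle : W ⊔ Submodule.span ℝ {z} ≤ W := by
      refine hmax ⟨sup_le (hWspan.trans (Submodule.span_mono ?_)) ?_, ?_⟩ le_sup_left
      · exact Set.inter_subset_inter_left _ (SetLike.coe_subset_coe.2 le_sup_left)
      · refine Submodule.span_mono (Set.singleton_subset_iff.2 ⟨?_, hz⟩)
        exact Submodule.mem_sup_right (Submodule.mem_span_singleton_self z)
      · intro w hw hlt hmem
        obtain ⟨z', hz', y, hy, hzy⟩ := mem_latticeAdd.1 hmem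
        obtain ⟨y', hy', y'', hy'', rfl⟩ := Submodule.mem_sup.1 hy
        obtain ⟨c, rfl⟩ := Submodule.mem_span_singleton.1 hy''
        refine key w hw hlt (-c) (mem_latticeAdd.2
          ⟨z', hz', y' + c • (z - g), W.add_mem hy' (W.smul_mem c hzg), ?_⟩)
        rw [← hzy, smul_sub, neg_smul]
        abel
    have hzW : z ∈ W := hle (Submodule.mem_sup_right (Submodule.mem_span_singleton_self z))
    rw [← hker, LinearMap.mem_ker] at hzW
    exact hv0 hzW
  refine ⟨p, ?_, hpd, π, hsurj, hlat, ?_, ?_, hnoshort⟩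
  · by_contra hp
    obtain rfl : p = 0 := by omega
    have hS : 0 ≤ ∑ i, α i := Finset.sum_nonneg fun i _ => hα i
    refine hW (fun _ => 1 / (1 + ∑ i, α i)) (fun i => by positivity) ?_ (mem_latticeAdd.2
      ⟨0, fun i => ⟨0, by simp⟩, _, ?_, zero_add _⟩)
    · rw [← Finset.sum_mul, mul_one_div, div_lt_one (by positivity)]
      linarith
    · rw [← hker, LinearMap.mem_ker]
      exact Subsingleton.elim _ _
  · refine isBounded_image_costBody hα π fun i hi => ?_
    by_contra hne
    refine hnoshort (π (e i)) (hlat ▸ Set.mem_image_of_mem π (heL i)) hne (ε / 2) (by positivity)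
      (by linarith) ⟨_, Set.sub_mem_sub ⟨_, ⟨Pi.single i (ε / 2)⁻¹, fun j => ?_, ?_, rfl⟩, rfl⟩
        ⟨_, ⟨0, fun _ => le_rfl, ?_, rfl⟩, rfl⟩, ?_⟩
    · by_cases h : j = i
      · subst h
        rw [Pi.single_eq_same]
        positivity
      · simp [h]
    · simp [Pi.single_apply, hi]
    · simp
    · simp [Pi.single_apply, ite_smul, smul_smul, hε.ne']
  · rw [Set.eq_empty_iff_forall_notMem]
    rintro y ⟨hy, hyint⟩
    obtain ⟨w, hw, hlt, rfl⟩ := exists_pos_of_mem_interior_image_costBody π hyint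
    rw [← hlat] at hy
    obtain ⟨z, hz, hzw⟩ := hy
    refine hW w hw hlt (mem_latticeAdd.2 ⟨z, hz, ∑ i, w i • e i - z, ?_, by abel⟩)
    rw [← hker, LinearMap.mem_ker, map_sub, hzw, sub_self]

/-- **existence of `t`-lc reductions.** Fix `d ≥ 1`, an ACC set `A ⊆ (0, ∞)`
and `t > 0`. There is `ε > 0`, depending only on `d` and `A`, such that for every finite
family of primitive vectors `e_i ∈ ℤ^d` spanning `ℝ^d` and reals `a_i ∈ [0, 1]` with
`a_i / t ∈ A` whenever `a_i > 0`, setting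
`U = conv({0} ∪ {(1/a_i) • e_i : a_i > 0}) + Σ_{a_i = 0} ℝ_{≥0} • e_i`, the following are
equivalent: (a) `ℤ^d ∩ int (t • U) = ∅`; (b) there is a surjective linear `π : ℝ^d → ℝ^p`
(`1 ≤ p ≤ d`) with `π(ℤ^d) = ℤ^p`, `π(U)` bounded, `ℤ^p ∩ int (t • π(U)) = ∅`, and no
nonzero lattice vector in `s • (t • π(U) - t • π(U))` for `0 < s < ε`. -/
theorem stmt_14 (d : ℕ) (hd : 1 ≤ d) (A : Set ℝ) (hA : A ⊆ Set.Ioi 0) (hACC : ACCSet A) :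
    ∃ ε : ℝ, 0 < ε ∧ ∀ t : ℝ, 0 < t →
      ∀ (n : ℕ) (e : Fin n → Fin d → ℤ) (a : Fin n → ℝ),
      (∀ i, Primitive (e i)) →
      Submodule.span ℝ (Set.range fun i => toReal (e i)) = ⊤ →
      (∀ i, 0 ≤ a i ∧ a i ≤ 1) →
      (∀ i, 0 < a i → a i / t ∈ A) →
      ∀ U : Set (Fin d → ℝ),
        U = convexHull ℝ ({0} ∪ {x | ∃ i, 0 < a i ∧ x = (1 / a i) • toReal (e i)}) +
            {x | ∃ c : Fin n → ℝ, (∀ i, 0 ≤ c i) ∧ (∀ i, a i ≠ 0 → c i = 0) ∧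
              x = ∑ i, c i • toReal (e i)} →
        ((intLat d ∩ interior (t • U) = ∅) ↔
          ∃ p : ℕ, 1 ≤ p ∧ p ≤ d ∧
            ∃ π : (Fin d → ℝ) →ₗ[ℝ] (Fin p → ℝ), Function.Surjective π ∧
              π '' intLat d = intLat p ∧
              Bornology.IsBounded (π '' U) ∧
              intLat p ∩ interior (t • (π '' U)) = ∅ ∧
              ∀ v ∈ intLat p, v ≠ 0 → ∀ s : ℝ, 0 < s → s < ε →
                v ∉ s • (t • (π '' U) - t • (π '' U))) := by
  obtain ⟨ε, hε, hshort⟩ := exists_short_adjoin_avoids d hA hACC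
  refine ⟨ε, hε, ?_⟩
  intro t ht n e a _ hspan ha haA U hU
  rw [convexHull_add_cone_eq_costBody (fun i => (ha i).1)] at hU
  have hπU : ∀ {p : ℕ} (π : (Fin d → ℝ) →ₗ[ℝ] (Fin p → ℝ)), t • (π '' U) = π '' (t • U) :=
    fun π => (Set.image_smul_comm π t U fun x => map_smul π t x).symm
  constructor
  · intro hempty
    rw [hU, smul_costBody a _ ht, Set.eq_empty_iff_forall_notMem] at hempty
    obtain ⟨p, hp1, hpd, π, hsurj, hlat, hbdd, hint, hns⟩ := exists_projection_of_avoids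
      (fun i => mem_intLat_iff.2 ⟨e i, rfl⟩) (fun i => div_nonneg (ha i).1 ht.le) hε
      (fun Γ hΓ => hshort n (fun i => toReal (e i)) (fun i => a i / t) Γ hΓ fun i => by
        rcases (ha i).1.eq_or_lt with h | h
        · exact Or.inr (by rw [← h, zero_div])
        · exact Or.inl (haA i h))
      fun w hw hlt hmem => hempty _ ⟨hmem, sum_smul_mem_interior_costBody hspan hw hlt⟩
    rw [← smul_costBody a _ ht, ← hU, ← hπU] at hbdd hint
    rw [← smul_costBody a _ ht, ← hU, ← hπU] at hns
    refine ⟨p, hp1, hpd, π, hsurj, hlat, ?_, hint, hns⟩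
    have := hbdd.smul₀ t⁻¹
    rwa [smul_smul, inv_mul_cancel₀ ht.ne', one_smul] at this
  · rintro ⟨p, -, -, π, hsurj, hlat, -, hint, -⟩
    rw [Set.eq_empty_iff_forall_notMem] at hint ⊢
    rintro z ⟨hz, hzint⟩
    refine hint (π z) ⟨hlat ▸ Set.mem_image_of_mem π hz, ?_⟩
    rw [hπU]
    exact image_interior_subset_interior_image hsurj _ (Set.mem_image_of_mem π hzint)
end

section
/- Let (e_i)_{i ∈ I} be a finite family of primitive vectors of ℤ^d spanning ℝ^d, let (a_i)_{i ∈ I} be real numbers with 0 ≤ a_i ≤ 1, and let t > 0. Set U = conv({0} ∪ {(1/a_i) • e_i : a_i > 0}) + Σ_{i : a_i = 0} ℝ_{≥0} • e_i. Let V₀ = span{e_i : a_i = 0} and assume V₀ ≠ ℝ^d; set d₀ = d − dim V₀ and let g : ℝ^d → ℝ^{d₀} be a surjective linear map with ker g = V₀ and g(ℤ^d) = ℤ^{d₀}. Then g(ℤ^d ∩ interior(t • U)) = ℤ^{d₀} ∩ interior(g(t • U)), where the first interior is taken in ℝ^d and the second in ℝ^{d₀}. -/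
open Pointwise

/-- The interior of a linear image of a convex set with nonempty interior is covered by the image
of its interior. -/
theorem interior_image_subset_of_convex {E F : Type*} [AddCommGroup E] [Module ℝ E]
    [TopologicalSpace E] [IsTopologicalAddGroup E] [ContinuousSMul ℝ E]
    [AddCommGroup F] [Module ℝ F] [TopologicalSpace F] [IsTopologicalAddGroup F]
    [ContinuousSMul ℝ F] (g : E →ₗ[ℝ] F) {K : Set E} (hK : Convex ℝ K)
    (hne : (interior K).Nonempty) : interior (g '' K) ⊆ g '' interior K := by
  intro y hy
  obtain ⟨q, hq⟩ := hne
  have hcont : Filter.Tendsto (fun s : ℝ => y + s • (y - g q)) (nhdsWithin 0 (Set.Ioi 0))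
      (nhds y) := by
    have h : Continuous fun s : ℝ => y + s • (y - g q) := by fun_prop
    simpa using (h.tendsto 0).mono_left nhdsWithin_le_nhds
  obtain ⟨s, ⟨k, hk, hks⟩, hs⟩ :=
    ((hcont.eventually (mem_interior_iff_mem_nhds.mp hy)).and self_mem_nhdsWithin).exists
  have hs : 0 < s := hs
  have hs1 : (1 + s) ≠ 0 := by positivity
  refine ⟨(1 / (1 + s)) • k + (s / (1 + s)) • q, hK.combo_self_interior_mem_interior hk hq
    (by positivity) (by positivity) (by field_simp), ?_⟩
  rw [map_add, map_smul, map_smul, hks]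
  match_scalars
  · field_simp
  · field_simp
    ring

/-- If `0 ∈ K` and every vector of a spanning family has a positive multiple in the convex set `K`,
then `K` has nonempty interior. -/
theorem interior_nonempty_of_span_eq_top {E ι : Type*} [NormedAddCommGroup E] [NormedSpace ℝ E]
    [FiniteDimensional ℝ E] {K : Set E} (hK : Convex ℝ K) (h0 : (0 : E) ∈ K) {v : ι → E}
    (hspan : Submodule.span ℝ (Set.range v) = ⊤) (hv : ∀ i, ∃ r : ℝ, 0 < r ∧ r • v i ∈ K) :
    (interior K).Nonempty := by
  rw [hK.interior_nonempty_iff_affineSpan_eq_top,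
    ← AffineSubspace.direction_eq_top_iff_of_nonempty ⟨0, subset_affineSpan ℝ K h0⟩,
    direction_affineSpan, eq_top_iff, ← hspan, Submodule.span_le]
  rintro _ ⟨i, rfl⟩
  obtain ⟨r, hr, hri⟩ := hv i
  have h := Submodule.smul_mem _ r⁻¹ (vsub_mem_vectorSpan ℝ hri h0)
  simpa [smul_smul, hr.ne'] using h

/-- An integer vector can be moved by integer multiples of the integer vectors `e i`, `i ∈ s`,
so that it differs from `p` by a nonnegative combination of them, provided it differs from `p` by an
element of their span. -/
theorem exists_intLat_sub_eq_sum_nonneg {d n : ℕ} (e : Fin n → Fin d → ℤ) (s : Set (Fin n))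
    {p x : Fin d → ℝ} (hx : x ∈ intLat d)
    (hxp : x - p ∈ Submodule.span ℝ ((fun i => toReal (e i)) '' s)) :
    ∃ z ∈ intLat d, z - x ∈ Submodule.span ℝ ((fun i => toReal (e i)) '' s) ∧
      ∃ c : Fin n → ℝ, (∀ i, 0 ≤ c i) ∧ (∀ i, i ∉ s → c i = 0) ∧
        z = p + ∑ i, c i • toReal (e i) := by
  obtain ⟨l, hl, hlx⟩ := (Finsupp.mem_span_image_iff_linearCombination ℝ).mp hxp
  rw [Finsupp.linearCombination_apply, Finsupp.sum_fintype _ _ (by simp)] at hlx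
  have hls : ∀ i, i ∉ s → l i = 0 := fun i hi => by
    by_contra h
    exact hi (hl (Finsupp.mem_support_iff.mpr h))
  refine ⟨x - ∑ i, (⌊l i⌋ : ℝ) • toReal (e i), fun j => ?_, ?_, fun i => Int.fract (l i),
    fun i => Int.fract_nonneg _, fun i hi => by simp [hls i hi], ?_⟩
  · obtain ⟨m, hm⟩ := hx j
    exact ⟨m - ∑ i, ⌊l i⌋ * e i j, by simp [hm, toReal]⟩
  · rw [sub_sub_cancel_left]
    refine Submodule.neg_mem _ (Submodule.sum_mem _ fun i _ => ?_)
    by_cases hi : i ∈ s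
    · exact Submodule.smul_mem _ _ (Submodule.subset_span ⟨i, hi, rfl⟩)
    · simp [hls i hi]
  · simp only [Int.fract, sub_smul, Finset.sum_sub_distrib, hlx]
    abel

/-- Let `(e_i)` be finitely many primitive vectors of `ℤ^d` spanning
`ℝ^d`, `a_i ∈ [0, 1]`, `t > 0`, and
`U = conv({0} ∪ {(1/a_i) • e_i : a_i > 0}) + Σ_{a_i = 0} ℝ_{≥0} • e_i`. Let
`V₀ = span{e_i : a_i = 0} ≠ ℝ^d`, `d₀ = d - dim V₀`, and let `g : ℝ^d → ℝ^{d₀}` be a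
surjective linear map with `ker g = V₀` and `g(ℤ^d) = ℤ^{d₀}`. Then
`g(ℤ^d ∩ int (t • U)) = ℤ^{d₀} ∩ int (g(t • U))`. -/
theorem stmt_15 (d : ℕ) (hd : 1 ≤ d) (n : ℕ) (e : Fin n → Fin d → ℤ) (a : Fin n → ℝ)
    (hprim : ∀ i, Primitive (e i))
    (hspan : Submodule.span ℝ (Set.range fun i => toReal (e i)) = ⊤)
    (ha : ∀ i, 0 ≤ a i ∧ a i ≤ 1) (t : ℝ) (ht : 0 < t)
    (U : Set (Fin d → ℝ))
    (hU : U = convexHull ℝ ({0} ∪ {x | ∃ i, 0 < a i ∧ x = (1 / a i) • toReal (e i)}) +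
      {x | ∃ c : Fin n → ℝ, (∀ i, 0 ≤ c i) ∧ (∀ i, a i ≠ 0 → c i = 0) ∧
        x = ∑ i, c i • toReal (e i)})
    (V₀ : Submodule ℝ (Fin d → ℝ))
    (hV₀ : V₀ = Submodule.span ℝ {x | ∃ i, a i = 0 ∧ x = toReal (e i)})
    (hV₀top : V₀ ≠ ⊤)
    (d₀ : ℕ) (hd₀ : d₀ = d - Module.finrank ℝ V₀)
    (g : (Fin d → ℝ) →ₗ[ℝ] (Fin d₀ → ℝ)) (hgs : Function.Surjective g)
    (hkg : LinearMap.ker g = V₀) (hglat : g '' intLat d = intLat d₀) :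
    g '' (intLat d ∩ interior (t • U)) = intLat d₀ ∩ interior (g '' (t • U)) := by
  set C : Set (Fin d → ℝ) := {x | ∃ c : Fin n → ℝ, (∀ i, 0 ≤ c i) ∧ (∀ i, a i ≠ 0 → c i = 0) ∧
    x = ∑ i, c i • toReal (e i)}
  have hCsmul : ∀ r : ℝ, 0 ≤ r → ∀ x ∈ C, r • x ∈ C := by
    rintro r hr _ ⟨c, h0, h1, rfl⟩
    exact ⟨fun i => r * c i, fun i => mul_nonneg hr (h0 i), fun i hi => by simp [h1 i hi],
      by simp [Finset.smul_sum, smul_smul]⟩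
  have hCadd : ∀ x ∈ C, ∀ y ∈ C, x + y ∈ C := by
    rintro _ ⟨c, h0, h1, rfl⟩ _ ⟨c', h0', h1', rfl⟩
    exact ⟨fun i => c i + c' i, fun i => add_nonneg (h0 i) (h0' i),
      fun i hi => by simp [h1 i hi, h1' i hi], by simp [add_smul, Finset.sum_add_distrib]⟩
  have hC0 : (0 : Fin d → ℝ) ∈ C := ⟨0, by simp, by simp, by simp⟩
  have hCconv : Convex ℝ C := fun x hx y hy r s hr hs _ =>
    hCadd _ (hCsmul r hr x hx) _ (hCsmul s hs y hy)
  have hUconv : Convex ℝ U := hU ▸ (convex_convexHull ℝ _).add hCconv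
  have h0hull : (0 : Fin d → ℝ) ∈
      convexHull ℝ ({0} ∪ {x | ∃ i, 0 < a i ∧ x = (1 / a i) • toReal (e i)}) :=
    subset_convexHull ℝ _ (Or.inl rfl)
  have hU0 : (0 : Fin d → ℝ) ∈ U := hU ▸ ⟨0, h0hull, 0, hC0, add_zero 0⟩
  have hUint : (interior U).Nonempty := by
    refine interior_nonempty_of_span_eq_top hUconv hU0 hspan fun i => ?_
    rcases (ha i).1.eq_or_lt with hi | hi
    · refine ⟨1, one_pos, hU ▸ ⟨0, h0hull, _, ⟨Pi.single i 1, fun j => ?_, fun j hj => ?_, rfl⟩, ?_⟩⟩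
      · by_cases h : j = i
        · subst h; simp
        · simp [h]
      · have h : j ≠ i := fun h => hj (h ▸ hi.symm)
        simp [h]
      · simp [Pi.single_apply]
    · exact ⟨1 / a i, by positivity, hU ▸ ⟨_, subset_convexHull ℝ _ (Or.inr ⟨i, hi, rfl⟩), 0, hC0,
        add_zero _⟩⟩
  have htUint : (interior (t • U)).Nonempty := by
    rw [interior_smul₀ ht.ne']
    exact hUint.smul_set
  have htUC : ∀ p ∈ interior (t • U), ∀ c ∈ C, p + c ∈ interior (t • U) := by
    intro p hp c hc
    refine interior_maximal (t := interior (t • U) + {c}) ?_ isOpen_interior.add_right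
      ⟨p, hp, c, rfl, rfl⟩
    rintro _ ⟨q, hq, c, rfl, rfl⟩
    obtain ⟨u, hu, rfl⟩ := interior_subset hq
    rw [hU] at hu
    obtain ⟨h, hh, b, hb, rfl⟩ := hu
    refine ⟨h + (b + t⁻¹ • c),
      hU ▸ ⟨h, hh, _, hCadd _ hb _ (hCsmul _ (by positivity) _ hc), rfl⟩, ?_⟩
    simp [smul_smul, ht.ne', add_assoc]
  have hV₀' : LinearMap.ker g = Submodule.span ℝ ((fun i => toReal (e i)) '' {i | a i = 0}) := by
    rw [hkg, hV₀]
    congr 1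
    ext x
    simp [eq_comm]
  apply Set.Subset.antisymm
  · rintro _ ⟨x, ⟨hxl, hxi⟩, rfl⟩
    exact ⟨hglat ▸ Set.mem_image_of_mem g hxl,
      (g.isOpenMap_of_finiteDimensional hgs).image_interior_subset _ (Set.mem_image_of_mem g hxi)⟩
  · rintro y ⟨hyl, hyi⟩
    obtain ⟨p, hp, rfl⟩ := interior_image_subset_of_convex g (hUconv.smul t) htUint hyi
    rw [← hglat] at hyl
    obtain ⟨x, hx, hxp⟩ := hyl
    obtain ⟨z, hz, hzx, c, hc0, hc1, hzc⟩ := exists_intLat_sub_eq_sum_nonneg e {i | a i = 0} (p := p)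
      hx (by rw [← hV₀', LinearMap.mem_ker, map_sub, hxp, sub_self])
    rw [← hV₀', LinearMap.mem_ker, map_sub, sub_eq_zero] at hzx
    exact ⟨z, ⟨hz, hzc ▸ htUC p hp _ ⟨c, hc0, hc1, rfl⟩⟩, hzx.trans hxp⟩
end

section
/- Fix d ≥ 1 and a set A ⊆ (0, ∞) satisfying ACC. Then there exists a finite set F ⊂ ℝ with the following property. Let e_1, …, e_n ∈ ℤ^d be primitive vectors such that the cone σ = Σ_{i=1}^n ℝ_{≥0} • e_i spans ℝ^d, satisfies σ ∩ (−σ) = {0}, and each ray ℝ_{≥0} • e_i is an extremal ray of σ (the rays ℝ_{≥0} • e_i are exactly the one-dimensional faces of σ). Let ψ : ℝ^d → ℝ be a linear form with a_i := ψ(e_i) ≥ 0 for all i, and set a = inf{ψ(v) : v ∈ ℤ^d ∩ interior σ}. If a > 0 and a_i / a ∈ A for all i, then a_i / a ∈ F for all i. -/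
open Pointwise

/-- The cone `Σ_i ℝ_{≥0} • e_i` generated by a finite family of integer vectors. -/
def coneOf {d n : ℕ} (e : Fin n → Fin d → ℤ) : Set (Fin d → ℝ) :=
  {x | ∃ c : Fin n → ℝ, (∀ i, 0 ≤ c i) ∧ x = ∑ i, c i • toReal (e i)}

/-- The ray `ℝ_{≥0} • v`. -/
def rayOf {d : ℕ} (v : Fin d → ℝ) : Set (Fin d → ℝ) := {w | ∃ r : ℝ, 0 ≤ r ∧ w = r • v}

/-- `ℝ_{≥0} • v` is an extremal ray of the convex cone `σ`. -/
def IsExtremalRay {d : ℕ} (σ : Set (Fin d → ℝ)) (v : Fin d → ℝ) : Prop :=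
  ∀ x ∈ σ, ∀ y ∈ σ, x + y ∈ rayOf v → x ∈ rayOf v ∧ y ∈ rayOf v

open Filter Topology
/-- The Kuratowski limit, along an ultrafilter, of a family of additive subgroups. -/
def AddSubgroup.ultralimit {α E : Type*} [AddCommGroup E] [TopologicalSpace E]
    [IsTopologicalAddGroup E] (U : Ultrafilter α) (L : α → AddSubgroup E) : AddSubgroup E where
  carrier := {y | ∀ V ∈ 𝓝 y, ∀ᶠ n in (U : Filter α), ∃ x ∈ L n, x ∈ V}
  zero_mem' := fun V hV => Eventually.of_forall fun n => ⟨0, (L n).zero_mem, mem_of_mem_nhds hV⟩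
  add_mem' := by
    intro a b ha hb V hV
    have h : (fun p : E × E => p.1 + p.2) ⁻¹' V ∈ 𝓝 a ×ˢ 𝓝 b := by
      rw [← nhds_prod_eq]
      exact continuous_add.continuousAt hV
    obtain ⟨V₁, h₁, V₂, h₂, hV⟩ := Filter.mem_prod_iff.1 h
    filter_upwards [ha V₁ h₁, hb V₂ h₂]
    rintro n ⟨x, hx, hxV⟩ ⟨y, hy, hyV⟩
    exact ⟨x + y, (L n).add_mem hx hy, hV (Set.mk_mem_prod hxV hyV)⟩
  neg_mem' := by
    intro a ha V hV
    filter_upwards [ha (Neg.neg ⁻¹' V) (continuous_neg.continuousAt hV)]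
    rintro n ⟨x, hx, hxV⟩
    exact ⟨-x, (L n).neg_mem hx, hxV⟩

namespace AddSubgroup

section Topological

variable {α E : Type*} [AddCommGroup E] [TopologicalSpace E] [IsTopologicalAddGroup E]
  {U : Ultrafilter α} {L : α → AddSubgroup E}

theorem mem_ultralimit {y : E} :
    y ∈ ultralimit U L ↔ ∀ V ∈ 𝓝 y, ∀ᶠ n in (U : Filter α), ∃ x ∈ L n, x ∈ V :=
  Iff.rfl

theorem mem_ultralimit_of_tendsto {f : α → E} {y : E} (hf : ∀ n, f n ∈ L n)
    (h : Tendsto f U (𝓝 y)) : y ∈ ultralimit U L := fun V hV => by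
  filter_upwards [h hV] with n hn using ⟨f n, hf n, hn⟩

theorem isClosed_ultralimit : IsClosed (ultralimit U L : Set E) := by
  refine isClosed_of_closure_subset fun y hy V hV => ?_
  obtain ⟨W, hWV, hW, hyW⟩ := mem_nhds_iff.1 hV
  obtain ⟨z, hzW, hz⟩ := mem_closure_iff.1 hy W hW hyW
  filter_upwards [hz W (hW.mem_nhds hzW)]
  rintro n ⟨x, hx, hxW⟩
  exact ⟨x, hx, hWV hxW⟩

end Topological

variable {α E : Type*} [NormedAddCommGroup E] {U : Ultrafilter α} {L : α → AddSubgroup E}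

theorem tendsto_infDist_ultralimit {Z : AddSubgroup E} (hZ : ∀ n, Z ≤ L n) {K : Set E}
    (hK : IsCompact K) (hKZ : ∀ x, ∃ z ∈ Z, x - z ∈ K) {f : α → E} (hf : ∀ n, f n ∈ L n) :
    Tendsto (fun n => Metric.infDist (f n) (ultralimit U L : Set E)) U (𝓝 0) := by
  choose z hz hzK using fun n => hKZ (f n)
  obtain ⟨y, -, hy⟩ := hK.ultrafilter_le_nhds (U.map fun n => f n - z n)
    (tendsto_principal.2 (Eventually.of_forall hzK))
  have hy : Tendsto (fun n => f n - z n) U (𝓝 y) := hy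
  have hyL : y ∈ ultralimit U L :=
    mem_ultralimit_of_tendsto (fun n => (L n).sub_mem (hf n) (hZ n (hz n))) hy
  have hzL (n : α) : z n ∈ ultralimit U L :=
    mem_ultralimit_of_tendsto (fun m => hZ m (hz n)) tendsto_const_nhds
  refine squeeze_zero (fun _ => Metric.infDist_nonneg) (fun n => ?_)
    (tendsto_iff_dist_tendsto_zero.1 hy)
  refine (Metric.infDist_le_dist_of_mem ((ultralimit U L).add_mem hyL (hzL n))).trans_eq ?_
  rw [dist_eq_norm, dist_eq_norm]
  congr 1
  abel

theorem infDist_sub_le (H : AddSubgroup E) {x l : E} (hl : l ∈ H) :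
    Metric.infDist (x - l) (H : Set E) ≤ Metric.infDist x (H : Set E) := by
  refine (Metric.le_infDist ⟨0, H.zero_mem⟩).2 fun y hy => ?_
  refine (Metric.infDist_le_dist_of_mem (H.sub_mem hy hl)).trans_eq ?_
  simp

theorem eventually_le_ultralimit [NormedSpace ℝ E] [ProperSpace E] {Z : AddSubgroup E}
    (hZ : ∀ n, Z ≤ L n) {K : Set E} (hK : IsCompact K) (hKZ : ∀ x, ∃ z ∈ Z, x - z ∈ K) :
    ∀ᶠ n in (U : Filter α), L n ≤ ultralimit U L := by
  set M := ultralimit U L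
  have hM : IsClosed (M : Set E) := isClosed_ultralimit
  have hM0 : (M : Set E).Nonempty := ⟨0, M.zero_mem⟩
  by_contra hcon
  rw [← Ultrafilter.eventually_not] at hcon
  have hex (n : α) : ∃ h ∈ L n, ¬ L n ≤ M → h ∉ M := by
    by_cases hn : L n ≤ M
    · exact ⟨0, (L n).zero_mem, fun h => (h hn).elim⟩
    · obtain ⟨h, hh, hhM⟩ := SetLike.not_le_iff_exists.1 hn
      exact ⟨h, hh, fun _ => hhM⟩
  choose h hhL hhM using hex
  choose l hlM hl using fun n => hM.exists_infDist_eq_dist hM0 (h n)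
  set s : α → E := fun n => h n - l n with hs
  have hsd (n : α) : Metric.infDist (h n) (M : Set E) = ‖s n‖ := by rw [hl, dist_eq_norm]
  have hs0 : Tendsto (fun n => ‖s n‖) U (𝓝 0) := by
    exact (tendsto_infDist_ultralimit (U := U) hZ hK hKZ hhL).congr hsd
  have hpos : ∀ᶠ n in (U : Filter α), 0 < ‖s n‖ := by
    filter_upwards [hcon] with n hn
    rw [norm_pos_iff, hs, sub_ne_zero]
    rintro heq
    exact hhM n hn (heq ▸ hlM n)
  obtain ⟨u, -, hu⟩ := (isCompact_closedBall (0 : E) 1).ultrafilter_le_nhds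
    (U.map fun n => ‖s n‖⁻¹ • s n) (tendsto_principal.2 (Eventually.of_forall fun n => by
      simp only [mem_closedBall_zero_iff, norm_smul, norm_inv, norm_norm]
      exact inv_mul_le_one))
  have hu : Tendsto (fun n => ‖s n‖⁻¹ • s n) U (𝓝 u) := hu
  have hline (t : ℝ) : t • u ∈ M := by
    have hm : Tendsto (fun n => (⌊t / ‖s n‖⌋ : ℝ) * ‖s n‖) U (𝓝 t) := by
      rw [tendsto_iff_dist_tendsto_zero]
      refine squeeze_zero' (Eventually.of_forall fun _ => dist_nonneg) ?_ hs0
      filter_upwards [hpos] with n hn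
      have h₁ := Int.floor_le (t / ‖s n‖)
      have h₂ := Int.lt_floor_add_one (t / ‖s n‖)
      rw [le_div_iff₀ hn] at h₁
      rw [div_lt_iff₀ hn] at h₂
      rw [Real.dist_eq, abs_le]
      constructor <;> linarith
    have hms : Tendsto (fun n => ⌊t / ‖s n‖⌋ • s n) U (𝓝 (t • u)) := by
      refine (hm.smul hu).congr' ?_
      filter_upwards [hpos] with n hn
      rw [smul_smul, mul_assoc, mul_inv_cancel₀ hn.ne', mul_one, Int.cast_smul_eq_zsmul]
    have h₁ := ((Metric.continuous_infDist_pt (M : Set E)).tendsto (t • u)).comp hms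
    have h₂ : Tendsto (fun n => Metric.infDist (⌊t / ‖s n‖⌋ • s n) (M : Set E)) U (𝓝 0) := by
      refine squeeze_zero (fun _ => Metric.infDist_nonneg) (fun n => ?_)
        (tendsto_infDist_ultralimit (U := U) hZ hK hKZ
          fun n => (L n).zsmul_mem (hhL n) ⌊t / ‖s n‖⌋)
      rw [hs, smul_sub]
      exact M.infDist_sub_le (M.zsmul_mem (hlM n) _)
    exact (hM.mem_iff_infDist_zero hM0).2 (tendsto_nhds_unique h₁ h₂)
  have hnear : ∀ᶠ n in (U : Filter α), dist (‖s n‖⁻¹ • s n) u < 1 :=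
    hu (Metric.ball_mem_nhds u one_pos)
  obtain ⟨n, hn, hn'⟩ := (hpos.and hnear).exists
  have hle := Metric.infDist_le_dist_of_mem (x := h n) (M.add_mem (hlM n) (hline ‖s n‖))
  have heq : h n - (l n + ‖s n‖ • u) = ‖s n‖ • (‖s n‖⁻¹ • s n - u) := by
    rw [smul_sub, smul_smul, mul_inv_cancel₀ hn.ne', one_smul, sub_add_eq_sub_sub]
  rw [hsd, dist_eq_norm, heq, norm_smul, norm_norm] at hle
  rw [dist_eq_norm] at hn'
  nlinarith

end AddSubgroup

theorem ACCSet.exists_isGreatest {A B : Set ℝ} (hA : ACCSet A) (hBA : B ⊆ A) (hB : B.Nonempty) :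
    ∃ m, IsGreatest B m := by
  by_contra! hcon
  have : Nonempty B := hB.to_subtype
  have : NoMaxOrder B := ⟨fun b => by
    by_contra! h
    exact hcon b ⟨b.2, fun c hc => h ⟨c, hc⟩⟩⟩
  obtain ⟨f, hf⟩ := Nat.exists_strictMono B
  exact hA ⟨fun n => f n, hf, fun n => hBA (f n).2⟩

theorem ACCSet.eventually_limit_le {A : Set ℝ} (hA : ACCSet A) {α : Type*} {l : Filter α}
    {b : α → ℝ} (hb : ∀ n, b n ∈ A) {β : ℝ} (h : Tendsto b l (𝓝 β)) : ∀ᶠ n in l, β ≤ b n := by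
  obtain hB | hB := (A ∩ Set.Iio β).eq_empty_or_nonempty
  · exact Eventually.of_forall fun n => not_lt.1 fun hn => Set.eq_empty_iff_forall_notMem.1 hB _
      ⟨hb n, hn⟩
  · obtain ⟨m, hm, hmax⟩ := hA.exists_isGreatest Set.inter_subset_left hB
    filter_upwards [h.eventually_const_lt hm.2] with n hn
    by_contra! hlt
    exact hn.not_ge (hmax ⟨hb n, hlt⟩)

/-- The vectors of `ℝ^ι` with integer coordinates. -/
def integralVectors (ι : Type*) : AddSubgroup (ι → ℝ) := ((Int.castAddHom ℝ).compLeft ι).range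

theorem integralVectors_le {ι : Type*} [Fintype ι] [DecidableEq ι] {L : AddSubgroup (ι → ℝ)}
    (hL : ∀ j, Pi.single j 1 ∈ L) : integralVectors ι ≤ L := by
  rintro _ ⟨z, rfl⟩
  have : (Int.castAddHom ℝ).compLeft ι z = ∑ j, z j • (Pi.single j 1 : ι → ℝ) := by
    ext i
    simp [Finset.sum_apply, Pi.single_apply]
  rw [this]
  exact L.sum_mem fun j _ => L.zsmul_mem (hL j) _

theorem exists_integralVectors_sub_mem_Icc {ι : Type*} (x : ι → ℝ) :
    ∃ z ∈ integralVectors ι, x - z ∈ Set.Icc (0 : ι → ℝ) 1 :=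
  ⟨_, ⟨fun i => ⌊x i⌋, rfl⟩, fun i => Int.fract_nonneg (x i), fun i => (Int.fract_lt_one (x i)).le⟩

theorem finite_setOf_positive_minimum_eq_one (ι : Type*) [Fintype ι] [DecidableEq ι] {A : Set ℝ}
    (hA : BddBelow A) (hACC : ACCSet A) :
    {b : ι → ℝ | (∀ j, b j ∈ A) ∧ ∃ L : AddSubgroup (ι → ℝ), (∀ j, Pi.single j 1 ∈ L) ∧
      (∀ c ∈ L, (∀ j, 0 < c j) → 1 ≤ b ⬝ᵥ c) ∧ ∃ x ∈ L, (∀ j, 0 < x j) ∧ b ⬝ᵥ x = 1}.Finite := by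
  by_contra hinf
  set f := Set.Infinite.natEmbedding _ hinf
  set b : ℕ → ι → ℝ := fun n => f n with hbdef
  have hbinj : Function.Injective b := Subtype.val_injective.comp f.injective
  have hbA (n : ℕ) : ∀ j, b n j ∈ A := (f n).2.1
  choose L hsingle hmin x hxL hxpos hx using fun n => (f n).2.2
  set U := hyperfilter ℕ
  obtain ⟨m, hm⟩ := hA
  obtain ⟨β, hβ⟩ : ∃ β, Tendsto b U (𝓝 β) := by
    obtain hι | ⟨⟨j⟩⟩ := isEmpty_or_nonempty ι
    · exact ⟨0, tendsto_const_nhds.congr fun n => Subsingleton.elim _ _⟩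
    obtain ⟨M, hM⟩ := hACC.exists_isGreatest subset_rfl ⟨_, hbA 0 j⟩
    obtain ⟨β, -, hβ⟩ := (isCompact_Icc (a := fun _ : ι => m) (b := fun _ => M)).ultrafilter_le_nhds
      (U.map b) (tendsto_principal.2 (Eventually.of_forall fun n =>
        ⟨fun j => hm (hbA n j), fun j => hM.2 (hbA n j)⟩))
    exact ⟨β, hβ⟩
  have hle : ∀ᶠ n in (U : Filter ℕ), ∀ j, β j ≤ b n j := eventually_all.2 fun j =>
    hACC.eventually_limit_le (fun n => hbA n j) (tendsto_pi_nhds.1 hβ j)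
  have hLM : ∀ᶠ n in (U : Filter ℕ), L n ≤ AddSubgroup.ultralimit U L :=
    AddSubgroup.eventually_le_ultralimit (fun n => integralVectors_le (hsingle n)) isCompact_Icc
      exists_integralVectors_sub_mem_Icc
  have hone (y : ι → ℝ) (hy : y ∈ AddSubgroup.ultralimit U L) (hpos : ∀ j, 0 < y j) :
      1 ≤ β ⬝ᵥ y := by
    by_contra! hlt
    have hcont : Continuous fun p : (ι → ℝ) × (ι → ℝ) => p.1 ⬝ᵥ p.2 :=
      continuous_fst.dotProduct continuous_snd
    have h := hcont.continuousAt.eventually_lt (x₀ := (β, y)) continuousAt_const hlt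
    rw [nhds_prod_eq] at h
    obtain ⟨P, hP, Q, hQ, hPQ⟩ := eventually_prod_iff.1 h
    have hQpos : ∀ᶠ c in 𝓝 y, ∀ j, 0 < c j := eventually_all.2 fun j =>
      (continuous_apply j).continuousAt.eventually_const_lt (hpos j)
    obtain ⟨n, hPn, c, hcL, hQc, hc⟩ :=
      ((hβ.eventually hP).and (AddSubgroup.mem_ultralimit.1 hy _ (hQ.and hQpos))).exists
    exact (hPQ hPn hQc).not_ge (hmin n c hcL hc)
  have heq : ∀ᶠ n in (U : Filter ℕ), b n = β := by
    filter_upwards [hle, hLM] with n hn hLn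
    have h₁ : b n ⬝ᵥ x n ≤ β ⬝ᵥ x n := (hx n).le.trans (hone _ (hLn (hxL n)) (hxpos n))
    have h₂ (j : ι) : β j * x n j ≤ b n j * x n j := mul_le_mul_of_nonneg_right (hn j) (hxpos n j).le
    have h₃ := (Finset.sum_eq_sum_iff_of_le fun j _ => h₂ j).1
      (le_antisymm (Finset.sum_le_sum fun j _ => h₂ j) h₁)
    ext j
    exact (mul_right_cancel₀ (hxpos n j).ne' (h₃ j (Finset.mem_univ j))).symm
  refine notMem_hyperfilter_of_finite (s := {n | b n = β}) ?_ heq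
  exact Set.Subsingleton.finite fun p hp q hq => hbinj (hp.trans hq.symm)

section Cone

variable {d n : ℕ} {e : Fin n → Fin d → ℤ}

theorem zero_mem_coneOf : (0 : Fin d → ℝ) ∈ coneOf e := ⟨0, fun _ => le_rfl, by simp⟩

theorem add_mem_coneOf {x y : Fin d → ℝ} (hx : x ∈ coneOf e) (hy : y ∈ coneOf e) :
    x + y ∈ coneOf e := by
  obtain ⟨c, hc, rfl⟩ := hx
  obtain ⟨c', hc', rfl⟩ := hy
  exact ⟨c + c', fun i => add_nonneg (hc i) (hc' i), by
    simp [add_smul, Finset.sum_add_distrib]⟩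

theorem smul_mem_coneOf {x : Fin d → ℝ} {r : ℝ} (hr : 0 ≤ r) (hx : x ∈ coneOf e) :
    r • x ∈ coneOf e := by
  obtain ⟨c, hc, rfl⟩ := hx
  exact ⟨r • c, fun i => mul_nonneg hr (hc i), by simp [Finset.smul_sum, mul_smul]⟩

theorem toReal_mem_coneOf (i : Fin n) : toReal (e i) ∈ coneOf e :=
  ⟨Pi.single i 1, fun j => by by_cases h : j = i <;> simp [h],
    by simp [Pi.single_apply]⟩

theorem sum_smul_mem_coneOf {ι : Type*} (s : Finset ι) {c : ι → ℝ} (hc : ∀ j ∈ s, 0 ≤ c j)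
    (g : ι → Fin n) : ∑ j ∈ s, c j • toReal (e (g j)) ∈ coneOf e :=
  Finset.sum_induction _ (· ∈ coneOf e) (fun _ _ => add_mem_coneOf) zero_mem_coneOf
    fun j hj => smul_mem_coneOf (hc j hj) (toReal_mem_coneOf (g j))

theorem smul_add_mem_interior_coneOf {v w : Fin d → ℝ} {r : ℝ} (hr : 0 < r)
    (hv : v ∈ interior (coneOf e)) (hw : w ∈ coneOf e) : r • v + w ∈ interior (coneOf e) := by
  rw [mem_interior_iff_mem_nhds] at hv ⊢
  have hcont : Continuous fun y : Fin d → ℝ => r⁻¹ • (y - w) := by fun_prop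
  have heq : r⁻¹ • (r • v + w - w) = v := by
    rw [add_sub_cancel_right, smul_smul, inv_mul_cancel₀ hr.ne', one_smul]
  filter_upwards [hcont.continuousAt.preimage_mem_nhds (heq.symm ▸ hv)] with y hy
  have := add_mem_coneOf (smul_mem_coneOf hr.le hy) hw
  rwa [smul_smul, mul_inv_cancel₀ hr.ne', one_smul, sub_add_cancel] at this

theorem sum_smul_mem_interior_coneOf {ι : Type*} [Fintype ι] {c c' : ι → ℝ} (g : ι → Fin n)
    (hc' : ∀ j, 0 < c' j)
    (h : ∑ j, c j • toReal (e (g j)) ∈ interior (coneOf e)) :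
    ∑ j, c' j • toReal (e (g j)) ∈ interior (coneOf e) := by
  obtain ⟨r, hr, hrc⟩ : ∃ r > 0, ∀ j, r * c j ≤ c' j := by
    have hev : ∀ᶠ r in 𝓝[>] (0 : ℝ), ∀ j, r * c j < c' j := eventually_all.2 fun j => by
      have : ContinuousAt (fun r : ℝ => r * c j) 0 := by fun_prop
      exact (this.eventually_lt_const (by simpa using hc' j)).filter_mono nhdsWithin_le_nhds
    obtain ⟨r, hr, hr0⟩ := (hev.and self_mem_nhdsWithin).exists
    exact ⟨r, hr0, fun j => (hr j).le⟩
  have hsplit : ∑ j, c' j • toReal (e (g j)) =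
      r • ∑ j, c j • toReal (e (g j)) + ∑ j, (c' j - r * c j) • toReal (e (g j)) := by
    rw [Finset.smul_sum, ← Finset.sum_add_distrib]
    refine Finset.sum_congr rfl fun j _ => ?_
    rw [smul_smul, ← add_smul, add_sub_cancel]
  rw [hsplit]
  exact smul_add_mem_interior_coneOf hr h
    (sum_smul_mem_coneOf _ (fun j _ => sub_nonneg.2 (hrc j)) g)

theorem exists_pos_combination_of_mem_coneOf {w : Fin d → ℝ} (hw : w ∈ coneOf e) :
    ∃ m ≤ d + 1, ∃ (g : Fin m → Fin n) (c : Fin m → ℝ), (∀ j, 0 < c j) ∧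
      w = ∑ j, c j • toReal (e (g j)) := by
  obtain ⟨c, hc, rfl⟩ := hw
  obtain h0 | hpos := (Finset.sum_nonneg fun i (_ : i ∈ Finset.univ) => hc i).eq_or_lt
  · refine ⟨0, by omega, Fin.elim0, Fin.elim0, fun j => j.elim0, ?_⟩
    have := (Finset.sum_eq_zero_iff_of_nonneg fun i _ => hc i).1 h0.symm
    simp only [Finset.univ_eq_empty, Finset.sum_empty]
    exact Finset.sum_eq_zero fun i hi => by rw [this i hi, zero_smul]
  · set C := ∑ i, c i
    have hmem : Finset.univ.centerMass c (fun i => toReal (e i)) ∈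
        convexHull ℝ (Set.range fun i => toReal (e i)) :=
      Finset.centerMass_mem_convexHull _ (fun i _ => hc i) hpos fun i _ => Set.mem_range_self i
    obtain ⟨ι, _, z, t, hz, hind, ht, -, hsum⟩ := eq_pos_convex_span_of_mem_convexHull hmem
    choose g hg using fun j => hz (Set.mem_range_self j)
    have hcard : Fintype.card ι ≤ d + 1 := by
      refine hind.card_le_finrank_succ.trans (Nat.succ_le_succ ?_)
      exact (Submodule.finrank_le _).trans_eq (by simp)
    set φ := (Fintype.equivFin ι).symm
    refine ⟨_, hcard, g ∘ φ, fun j => C * t (φ j), fun j => mul_pos hpos (ht _), ?_⟩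
    have hre : ∑ j, (C * t (φ j)) • toReal (e ((g ∘ φ) j)) = ∑ j, (C * t j) • toReal (e (g j)) :=
      φ.sum_comp fun j => (C * t j) • toReal (e (g j))
    rw [hre]
    simp only [mul_smul, hg, ← Finset.smul_sum, hsum, Finset.centerMass]
    rw [smul_smul, mul_inv_cancel₀ hpos.ne', one_smul]

theorem exists_pos_combination_of_mem_interior_coneOf {v : Fin d → ℝ}
    (hv : v ∈ interior (coneOf e)) (i : Fin n) :
    ∃ m ≤ d + 2, ∃ (g : Fin m → Fin n) (c : Fin m → ℝ), (∀ j, 0 < c j) ∧ (∃ j, g j = i) ∧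
      v = ∑ j, c j • toReal (e (g j)) := by
  have hev : ∀ᶠ r in 𝓝[>] (0 : ℝ), v - r • toReal (e i) ∈ coneOf e := by
    have : ContinuousAt (fun r : ℝ => v - r • toReal (e i)) 0 := by fun_prop
    refine (this.eventually ?_).filter_mono nhdsWithin_le_nhds
    simpa using mem_interior_iff_mem_nhds.1 hv
  obtain ⟨r, hr, hr0⟩ := (hev.and self_mem_nhdsWithin).exists
  obtain ⟨m, hm, g, c, hc, hsum⟩ := exists_pos_combination_of_mem_coneOf hr
  refine ⟨m + 1, by omega, Fin.cons i g, Fin.cons r c, fun j => ?_, ⟨0, rfl⟩, ?_⟩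
  · induction j using Fin.cases with
    | zero => exact hr0
    | succ j => exact hc j
  · simp [Fin.sum_univ_succ, ← hsum]

theorem finite_intLat_inter_coneOf_le {ψ : (Fin d → ℝ) →ₗ[ℝ] ℝ} (hψ : ∀ i, 0 < ψ (toReal (e i)))
    (R : ℝ) : {v | v ∈ intLat d ∧ v ∈ coneOf e ∧ ψ v ≤ R}.Finite := by
  set B : ℝ := ∑ i, R / ψ (toReal (e i)) * ‖toReal (e i)‖
  have hbound : ∀ v ∈ coneOf e, ψ v ≤ R → ‖v‖ ≤ B := by
    rintro _ ⟨c, hc, rfl⟩ hR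
    refine (norm_sum_le _ _).trans (Finset.sum_le_sum fun i _ => ?_)
    rw [norm_smul, Real.norm_of_nonneg (hc i)]
    refine mul_le_mul_of_nonneg_right ((le_div_iff₀ (hψ i)).2 (le_trans ?_ hR)) (norm_nonneg _)
    simp only [map_sum, map_smul, smul_eq_mul]
    exact Finset.single_le_sum (f := fun i => c i * ψ (toReal (e i)))
      (fun j _ => mul_nonneg (hc j) (hψ j).le) (Finset.mem_univ i)
  refine ((Set.finite_Icc (fun _ : Fin d => -⌈B⌉) (fun _ => ⌈B⌉)).image toReal).subset ?_
  rintro v ⟨hv, hvσ, hvR⟩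
  choose z hz using hv
  refine ⟨z, ?_, funext fun i => (hz i).symm⟩
  have hzB (i : Fin d) : |(z i : ℝ)| ≤ ⌈B⌉ := by
    rw [← hz]
    exact (norm_le_pi_norm v i).trans ((hbound v hvσ hvR).trans (Int.le_ceil B))
  exact ⟨fun i => by exact_mod_cast (abs_le.1 (hzB i)).1,
    fun i => by exact_mod_cast (abs_le.1 (hzB i)).2⟩

theorem exists_isLeast_intLat_inter_interior_coneOf {ψ : (Fin d → ℝ) →ₗ[ℝ] ℝ}
    (hψ : ∀ i, 0 < ψ (toReal (e i))) (hne : (intLat d ∩ interior (coneOf e)).Nonempty) :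
    ∃ v ∈ intLat d ∩ interior (coneOf e), ∀ u ∈ intLat d ∩ interior (coneOf e), ψ v ≤ ψ u := by
  obtain ⟨w, hw⟩ := hne
  have hfin : {v | v ∈ intLat d ∩ interior (coneOf e) ∧ ψ v ≤ ψ w}.Finite :=
    (finite_intLat_inter_coneOf_le hψ (ψ w)).subset fun v hv =>
      ⟨hv.1.1, interior_subset hv.1.2, hv.2⟩
  obtain ⟨v, hv, hmin⟩ := Set.exists_min_image _ ψ hfin ⟨w, hw, le_rfl⟩
  refine ⟨v, hv.1, fun u hu => ?_⟩
  obtain h | h := le_total (ψ u) (ψ w)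
  · exact hmin u ⟨hu, h⟩
  · exact hv.2.trans h

end Cone

/-- The coefficient vectors `c` for which `∑ j, c j • g j` is an integral vector. -/
def coefficientLattice {ι : Type*} [Fintype ι] {d : ℕ} (g : ι → Fin d → ℤ) :
    AddSubgroup (ι → ℝ) :=
  (integralVectors (Fin d)).comap (Fintype.linearCombination ℝ fun j => toReal (g j)).toAddMonoidHom

theorem toReal_mem_intLat {d : ℕ} (z : Fin d → ℤ) : toReal z ∈ intLat d := fun i => ⟨z i, rfl⟩

theorem mem_intLat_iff_s16 {d : ℕ} {v : Fin d → ℝ} : v ∈ intLat d ↔ v ∈ integralVectors (Fin d) := by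
  constructor
  · intro h
    choose z hz using h
    exact ⟨z, funext fun i => (hz i).symm⟩
  · rintro ⟨z, rfl⟩
    exact toReal_mem_intLat z

theorem mem_coefficientLattice {ι : Type*} [Fintype ι] {d : ℕ} {g : ι → Fin d → ℤ} {c : ι → ℝ} :
    c ∈ coefficientLattice g ↔ ∑ j, c j • toReal (g j) ∈ intLat d :=
  mem_intLat_iff_s16.symm

/-- Fix `d ≥ 1` and an ACC set `A ⊆ (0, ∞)`. There is a finite set
`F ⊂ ℝ` such that: for every family of primitive `e_1, …, e_n ∈ ℤ^d` whose cone
`σ = Σ ℝ_{≥0} • e_i` spans `ℝ^d`, is strongly convex (`σ ∩ (-σ) = {0}`) and has the rays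
`ℝ_{≥0} • e_i` as extremal rays, and every linear form `ψ` with `a_i := ψ(e_i) ≥ 0`, if
`a = inf {ψ(v) : v ∈ ℤ^d ∩ int σ} > 0` and `a_i / a ∈ A` for all `i`, then `a_i / a ∈ F`
for all `i`. -/
theorem stmt_16 (d : ℕ) (hd : 1 ≤ d) (A : Set ℝ) (hA : A ⊆ Set.Ioi 0) (hACC : ACCSet A) :
    ∃ F : Finset ℝ, ∀ (n : ℕ) (e : Fin n → Fin d → ℤ),
      (∀ i, Primitive (e i)) →
      Submodule.span ℝ (coneOf e) = ⊤ →
      coneOf e ∩ (-(coneOf e)) = {0} →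
      (∀ i, IsExtremalRay (coneOf e) (toReal (e i))) →
      ∀ ψ : (Fin d → ℝ) →ₗ[ℝ] ℝ,
      (∀ i, 0 ≤ ψ (toReal (e i))) →
      ∀ a : ℝ, a = sInf {r | ∃ v ∈ intLat d ∩ interior (coneOf e), r = ψ v} →
      0 < a →
      (∀ i, ψ (toReal (e i)) / a ∈ A) →
      ∀ i, ψ (toReal (e i)) / a ∈ F := by
  set G : ℕ → Set ℝ := fun m => ⋃ b ∈ {b : Fin m → ℝ | (∀ j, b j ∈ A) ∧
    ∃ L : AddSubgroup (Fin m → ℝ), (∀ j, Pi.single j 1 ∈ L) ∧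
      (∀ c ∈ L, (∀ j, 0 < c j) → 1 ≤ b ⬝ᵥ c) ∧ ∃ x ∈ L, (∀ j, 0 < x j) ∧ b ⬝ᵥ x = 1}, Set.range b
    with hG
  have hGfin (m : ℕ) : (G m).Finite :=
    (finite_setOf_positive_minimum_eq_one (Fin m) ⟨0, fun x hx => (hA hx).le⟩ hACC).biUnion
      fun b _ => Set.finite_range b
  have hfin : (⋃ m ∈ Set.Iic (d + 2), G m).Finite :=
    (Set.finite_Iic (d + 2)).biUnion fun m _ => hGfin m
  refine ⟨hfin.toFinset, fun n e _ _ _ _ ψ _ a ha ha0 hmem i => ?_⟩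
  have hψ (i : Fin n) : 0 < ψ (toReal (e i)) := (div_pos_iff_of_pos_right ha0).1 (hA (hmem i))
  have hne : (intLat d ∩ interior (coneOf e)).Nonempty := by
    by_contra hempty
    rw [Set.not_nonempty_iff_eq_empty] at hempty
    simp [hempty] at ha
    exact ha0.ne' ha
  obtain ⟨v, hv, hmin⟩ := exists_isLeast_intLat_inter_interior_coneOf hψ hne
  have hav : a = ψ v := by
    rw [ha]
    refine IsLeast.csInf_eq ⟨⟨v, hv, rfl⟩, ?_⟩
    rintro _ ⟨u, hu, rfl⟩
    exact hmin u hu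
  obtain ⟨m, hm, g, c, hc, ⟨j, rfl⟩, hsum⟩ := exists_pos_combination_of_mem_interior_coneOf hv.2 i
  rw [Set.Finite.mem_toFinset]
  have hdot (c : Fin m → ℝ) : (fun j => ψ (toReal (e (g j))) / a) ⬝ᵥ c =
      ψ (∑ j, c j • toReal (e (g j))) / a := by
    simp only [dotProduct, map_sum, map_smul, smul_eq_mul, Finset.sum_div]
    exact Finset.sum_congr rfl fun j _ => by ring
  refine Set.mem_biUnion (Set.mem_Iic.2 hm) (Set.mem_biUnion (x := fun j => ψ (toReal (e (g j))) / a)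
    ⟨fun j => hmem (g j), coefficientLattice fun j => e (g j), fun j => ?_, fun c' hc'L hc' => ?_,
      c, ?_, hc, ?_⟩ ⟨j, rfl⟩)
  · rw [mem_coefficientLattice]
    simpa [Pi.single_apply] using toReal_mem_intLat (e (g j))
  · rw [hdot, one_le_div ha0, hav]
    exact hmin _ ⟨mem_coefficientLattice.1 hc'L,
      sum_smul_mem_interior_coneOf g hc' (hsum ▸ hv.2)⟩
  · rw [mem_coefficientLattice, ← hsum]
    exact hv.1
  · rw [hdot, ← hsum, ← hav, div_self ha0.ne']
end

section
/- Fix d ≥ 1 and a set A ⊆ (0, ∞) satisfying ACC. Then there exists a finite family 𝒢 of closed additive subgroups of ℝ^d, each containing ℤ^d and different from ℝ^d, with the following property. Let t > 0 and let a_1, …, a_d be positive reals with a_i / t ∈ A for all i; set W = {x ∈ ℝ^d : x_i ≥ 0 for all i and Σ_{i=1}^d a_i x_i ≤ t}. Let N be a discrete additive subgroup of ℝ^d with ℤ^d ⊆ N such that every standard basis vector e_i is primitive in N (that is, (1/k) • e_i ∉ N for every integer k ≥ 2). Then N ∩ interior(W) = ∅ if and only if there exists G ∈ 𝒢 with N ⊆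 G and G ∩ interior(W) = ∅. -/
open Pointwise

section ClosedSubgroups

open Filter Topology

variable {E : Type*} [NormedAddCommGroup E] [NormedSpace ℝ E]

/-- The largest linear subspace contained in an additive subgroup. -/
def AddSubgroup.linealSpace (H : AddSubgroup E) : Submodule ℝ E where
  carrier := {v | ∀ s : ℝ, s • v ∈ H}
  add_mem' hx hy s := by rw [smul_add]; exact H.add_mem (hx s) (hy s)
  zero_mem' s := by simp
  smul_mem' c x hx s := by rw [smul_smul]; exact hx _

theorem AddSubgroup.mem_of_mem_linealSpace {H : AddSubgroup E} {v : E}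
    (hv : v ∈ H.linealSpace) : v ∈ H := by
  simpa using hv 1

/-- A limit of directions of small elements of a closed subgroup spans a line in it. -/
theorem AddSubgroup.mem_linealSpace_of_tendsto {H : AddSubgroup E}
    (hH : IsClosed (H : Set E)) {w : ℕ → E} (hw : ∀ n, w n ∈ H) (hw0 : ∀ n, w n ≠ 0)
    (hlim : Tendsto w atTop (𝓝 0)) {u : E}
    (hu : Tendsto (fun n => ‖w n‖⁻¹ • w n) atTop (𝓝 u)) : u ∈ H.linealSpace := by
  intro s
  have hfloor : Tendsto (fun n => (⌊s / ‖w n‖⌋ : ℝ) * ‖w n‖) atTop (𝓝 s) := by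
    have hn : Tendsto (fun n => s - ‖w n‖) atTop (𝓝 s) := by
      simpa using tendsto_const_nhds.sub hlim.norm
    refine tendsto_of_tendsto_of_tendsto_of_le_of_le hn tendsto_const_nhds
      (fun n => ?_) (fun n => ?_)
    · have hpos : 0 < ‖w n‖ := norm_pos_iff.2 (hw0 n)
      have h1 := (Int.lt_floor_add_one (s / ‖w n‖)).le
      rw [div_le_iff₀ hpos] at h1
      show s - ‖w n‖ ≤ (⌊s / ‖w n‖⌋ : ℝ) * ‖w n‖
      linarith
    · have hpos : 0 < ‖w n‖ := norm_pos_iff.2 (hw0 n)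
      have h1 := Int.floor_le (s / ‖w n‖)
      rwa [le_div_iff₀ hpos] at h1
  refine hH.mem_of_tendsto (hfloor.smul hu) (Eventually.of_forall fun n => ?_)
  have hne : ‖w n‖ ≠ 0 := norm_ne_zero_iff.2 (hw0 n)
  rw [smul_smul, mul_assoc, mul_inv_cancel₀ hne, mul_one, Int.cast_smul_eq_zsmul]
  exact H.zsmul_mem (hw n) _

variable [FiniteDimensional ℝ E]

theorem AddSubgroup.exists_forall_norm_lt_mem_linealSpace {H : AddSubgroup E}
    (hH : IsClosed (H : Set E)) :
    ∃ ε > 0, ∀ h ∈ H, ‖h‖ < ε → h ∈ H.linealSpace := by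
  by_contra! hcon
  obtain ⟨f, hf⟩ := Submodule.ClosedComplemented.of_finiteDimensional H.linealSpace
  choose h hhH hhn hhV using fun n : ℕ => hcon (1 / ((n : ℝ) + 1)) (by positivity)
  have hh0 : Tendsto h atTop (𝓝 0) :=
    squeeze_zero_norm (fun n => (hhn n).le) tendsto_one_div_add_atTop_nhds_zero_nat
  set w : ℕ → E := fun n => h n - f (h n) with hwdef
  have hwH : ∀ n, w n ∈ H := fun n =>
    H.sub_mem (hhH n) (AddSubgroup.mem_of_mem_linealSpace (f (h n)).2)
  have hw0 : ∀ n, w n ≠ 0 := fun n hn => hhV n (by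
    rw [sub_eq_zero.1 hn]; exact (f (h n)).2)
  have hfw : ∀ n, f (w n) = 0 := fun n => by simp [hwdef, hf]
  have hwlim : Tendsto w atTop (𝓝 0) := by
    have hc : Continuous fun x : E => x - (f x : E) := by fun_prop
    have := (hc.tendsto 0).comp hh0
    simpa [hwdef, Function.comp_def] using this
  obtain ⟨u, hu, φ, hφ, hφlim⟩ := (isCompact_sphere (0 : E) 1).tendsto_subseq
    (x := fun n => ‖w n‖⁻¹ • w n) (fun n => by
      simp [norm_smul, inv_mul_cancel₀ (norm_ne_zero_iff.2 (hw0 n))])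
  have huV : u ∈ H.linealSpace :=
    AddSubgroup.mem_linealSpace_of_tendsto hH (w := w ∘ φ) (fun n => hwH _) (fun n => hw0 _)
      (hwlim.comp hφ.tendsto_atTop) hφlim
  have hfu : f u = 0 := by
    refine tendsto_nhds_unique ((f.continuous.tendsto u).comp hφlim) ?_
    simp [Function.comp_def, hfw]
  have hu0 : u = 0 := by
    have := hf ⟨u, huV⟩
    rw [hfu] at this
    exact (congrArg Subtype.val this).symm
  simp [hu0] at hu

/-- Subgroups contained in a small uniform neighbourhood of a closed subgroup of a
finite-dimensional space are contained in it. -/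
theorem AddSubgroup.exists_le_of_uniformly_close {H : AddSubgroup E}
    (hH : IsClosed (H : Set E)) :
    ∃ δ > 0, ∀ N : AddSubgroup E, (∀ y ∈ N, ∃ h ∈ H, ‖y - h‖ < δ) → N ≤ H := by
  obtain ⟨ε, hε, hεV⟩ := AddSubgroup.exists_forall_norm_lt_mem_linealSpace hH
  obtain ⟨f, hf⟩ := Submodule.ClosedComplemented.of_finiteDimensional H.linealSpace
  set p : E →L[ℝ] E := ContinuousLinearMap.id ℝ E - H.linealSpace.subtypeL.comp f with hp
  have hpV : ∀ v ∈ H.linealSpace, p v = 0 := fun v hv => by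
    have := congrArg Subtype.val (hf ⟨v, hv⟩)
    simpa [hp, sub_eq_zero] using this.symm
  have hVp : ∀ v, p v = 0 → v ∈ H.linealSpace := fun v hv => by
    have h1 : v = f v := by simpa [hp, sub_eq_zero] using hv
    rw [h1]; exact (f v).2
  refine ⟨ε / 3, by positivity, fun N hN => ?_⟩
  have key : ∀ n : ℕ, ∀ y ∈ N, ∀ h ∈ H, ‖y - h‖ < ε / 3 →
      ‖p (y - h)‖ ≤ ‖p‖ * (ε / 3) * (1 / 2) ^ n := by
    intro n
    induction n with
    | zero =>
      intro y _ h _ hyh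
      simpa using (p.le_opNorm _).trans (mul_le_mul_of_nonneg_left hyh.le (norm_nonneg p))
    | succ n ih =>
      intro y hy h hh hyh
      obtain ⟨h', hh', hyh'⟩ := hN (y + y) (N.add_mem hy hy)
      have hV : h' - (h + h) ∈ H.linealSpace := by
        refine hεV _ (H.sub_mem hh' (H.add_mem hh hh)) ?_
        have heq : h' - (h + h) = (y - h) + (y - h) - (y + y - h') := by abel
        rw [heq]
        have h1 := norm_sub_le ((y - h) + (y - h)) (y + y - h')
        have h2 := norm_add_le (y - h) (y - h)
        linarith
      have hpe : p (y - h) = (1 / 2 : ℝ) • p (y + y - h') := by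
        have heq : y + y - h' = (2 : ℝ) • (y - h) - (h' - (h + h)) := by
          rw [two_smul]; abel
        rw [heq, map_sub p (_ • _), hpV _ hV, sub_zero, map_smul, smul_smul]
        norm_num
      have hb := ih (y + y) (N.add_mem hy hy) h' hh' hyh'
      rw [hpe, norm_smul, pow_succ]
      norm_num at hb ⊢
      linarith
  intro y hy
  obtain ⟨h, hh, hyh⟩ := hN y hy
  have hle : ‖p (y - h)‖ ≤ 0 := by
    refine ge_of_tendsto' (x := atTop) ?_ (fun n : ℕ => key n y hy h hh hyh)
    simpa using (tendsto_pow_atTop_nhds_zero_of_lt_one (r := (1 / 2 : ℝ)) (by norm_num)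
      (by norm_num)).const_mul (‖p‖ * (ε / 3))
  have hmem := AddSubgroup.mem_of_mem_linealSpace (hVp _ (norm_le_zero_iff.1 hle))
  simpa using H.add_mem hmem hh

end ClosedSubgroups

section Limits

open Filter Topology

/-- The lower Kuratowski limit of a family of additive subgroups along a filter. -/
def AddSubgroup.lowerLimit {E P : Type*} [SeminormedAddCommGroup E] (F : Filter P)
    (N : P → AddSubgroup E) : AddSubgroup E where
  carrier := {x | ∀ ε > 0, ∀ᶠ q in F, ∃ y ∈ N q, ‖y - x‖ < ε}
  add_mem' {a b} ha hb ε hε := by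
    filter_upwards [ha (ε / 2) (half_pos hε), hb (ε / 2) (half_pos hε)] with q ⟨y, hy, hya⟩
      ⟨z, hz, hzb⟩
    refine ⟨y + z, (N q).add_mem hy hz, ?_⟩
    rw [add_sub_add_comm]
    exact (norm_add_le _ _).trans_lt (by linarith)
  zero_mem' ε hε := Eventually.of_forall fun q => ⟨0, (N q).zero_mem, by simpa using hε⟩
  neg_mem' {a} ha ε hε := by
    filter_upwards [ha ε hε] with q ⟨y, hy, hya⟩
    refine ⟨-y, (N q).neg_mem hy, ?_⟩
    rwa [← neg_sub', norm_neg]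

theorem AddSubgroup.isClosed_lowerLimit {E P : Type*} [SeminormedAddCommGroup E] (F : Filter P)
    (N : P → AddSubgroup E) : IsClosed (AddSubgroup.lowerLimit F N : Set E) := by
  refine isClosed_of_closure_subset fun x hx ε hε => ?_
  obtain ⟨z, hz, hxz⟩ := Metric.mem_closure_iff.1 hx (ε / 2) (half_pos hε)
  filter_upwards [hz (ε / 2) (half_pos hε)] with q ⟨y, hy, hyz⟩
  refine ⟨y, hy, ?_⟩
  rw [← dist_eq_norm] at hyz ⊢
  have := dist_triangle y z x
  rw [dist_comm z x] at this
  linarith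

/-- Along an ultrafilter, subgroups containing `ℤ^d` are eventually contained in their limit. -/
theorem AddSubgroup.eventually_le_lowerLimit {d : ℕ} {P : Type*} (F : Ultrafilter P)
    (N : P → AddSubgroup (Fin d → ℝ)) (hN : ∀ q, intLat d ⊆ (N q : Set (Fin d → ℝ))) :
    ∀ᶠ q in (F : Filter P), N q ≤ AddSubgroup.lowerLimit F N := by
  set H := AddSubgroup.lowerLimit (F : Filter P) N with hHdef
  have hHZ : ∀ z ∈ intLat d, z ∈ H := fun z hz ε hε =>
    Eventually.of_forall fun q => ⟨z, hN q hz, by simpa using hε⟩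
  obtain ⟨δ, hδ, hδH⟩ := AddSubgroup.exists_le_of_uniformly_close
    (AddSubgroup.isClosed_lowerLimit (F : Filter P) N)
  have hK : IsCompact (Set.Icc (0 : Fin d → ℝ) 1 \ Metric.thickening δ (H : Set (Fin d → ℝ))) :=
    isCompact_Icc.diff Metric.isOpen_thickening
  have hempty : ∀ᶠ q in (F : Filter P), ∀ y ∈ N q,
      y ∉ Set.Icc (0 : Fin d → ℝ) 1 \ Metric.thickening δ (H : Set (Fin d → ℝ)) := by
    refine hK.induction_on (p := fun s => ∀ᶠ q in (F : Filter P), ∀ y ∈ N q, y ∉ s) ?_ ?_ ?_ ?_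
    · simp
    · intro s t hst ht
      filter_upwards [ht] with q hq y hy hys using hq y hy (hst hys)
    · intro s t hs ht
      filter_upwards [hs, ht] with q hqs hqt y hy hyst
      exact hyst.elim (hqs y hy) (hqt y hy)
    · intro x hx
      have hxH : x ∉ H := fun h => hx.2 (Metric.self_subset_thickening hδ _ h)
      have hxH' : ¬ ∀ ε > 0, ∀ᶠ q in (F : Filter P), ∃ y ∈ N q, ‖y - x‖ < ε := hxH
      push Not at hxH'
      obtain ⟨ε, hε, hne⟩ := hxH'
      refine ⟨Metric.ball x ε, mem_nhdsWithin_of_mem_nhds (Metric.ball_mem_nhds x hε), ?_⟩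
      filter_upwards [hne] with q hq y hy hyx
      rw [Metric.mem_ball, dist_eq_norm] at hyx
      exact absurd hyx (not_lt.2 (hq y hy))
  filter_upwards [hempty] with q hq
  refine hδH _ fun y hy => ?_
  set z : Fin d → ℝ := fun i => (⌊y i⌋ : ℝ) with hz
  have hzZ : z ∈ intLat d := fun i => ⟨⌊y i⌋, rfl⟩
  have hyz := hq (y - z) ((N q).sub_mem hy (hN q hzZ))
  have hcube : y - z ∈ Set.Icc (0 : Fin d → ℝ) 1 :=
    ⟨fun i => Int.fract_nonneg (y i), fun i => (Int.fract_lt_one (y i)).le⟩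
  have hthick : y - z ∈ Metric.thickening δ (H : Set (Fin d → ℝ)) := by
    by_contra hcon
    exact hyz ⟨hcube, hcon⟩
  obtain ⟨h, hh, hdist⟩ := Metric.mem_thickening_iff.1 hthick
  refine ⟨h + z, H.add_mem hh (hHZ z hzZ), ?_⟩
  rwa [dist_eq_norm, sub_sub, add_comm z h] at hdist

/-- Along an ultrafilter, a family valued in an ACC set is essentially non-increasing. -/
theorem ACCSet.eventually_eventually_le {A : Set ℝ} (hA : ACCSet A) {P : Type*}
    (F : Ultrafilter P) (b : P → ℝ) (hb : ∀ p, b p ∈ A) :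
    ∀ᶠ p in (F : Filter P), ∀ᶠ q in (F : Filter P), b q ≤ b p := by
  by_contra hcon
  have hev : ∀ᶠ p in (F : Filter P), ∀ᶠ q in (F : Filter P), b p < b q := by
    filter_upwards [Ultrafilter.eventually_not.2 hcon] with p hp
    filter_upwards [Ultrafilter.eventually_not.2 hp] with q hq using not_le.1 hq
  have hstep : ∀ p : {p // ∀ᶠ q in (F : Filter P), b p < b q},
      ∃ q : {p // ∀ᶠ q in (F : Filter P), b p < b q}, b p < b q := fun p => by
    obtain ⟨q, hq1, hq2⟩ := (hev.and p.2).exists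
    exact ⟨⟨q, hq1⟩, hq2⟩
  choose next hnext using hstep
  obtain ⟨p₀, hp₀⟩ := hev.exists
  refine hA ⟨fun n => b (next^[n] ⟨p₀, hp₀⟩).1, strictMono_nat_of_lt_succ fun n => ?_,
    fun n => hb _⟩
  rw [Function.iterate_succ_apply']
  exact hnext _

end Limits

/-- The open simplex `{x | 0 < x, ∑ b i * x i < 1}`. -/
def openSimplex {d : ℕ} (b : Fin d → ℝ) : Set (Fin d → ℝ) :=
  {x | (∀ i, 0 < x i) ∧ ∑ i, b i * x i < 1}

theorem isOpen_openSimplex {d : ℕ} (b : Fin d → ℝ) : IsOpen (openSimplex b) := by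
  rw [openSimplex, Set.ofPred_and, Set.ofPred_forall]
  exact (isOpen_iInter_of_finite fun i =>
    isOpen_lt continuous_const (continuous_apply i)).inter
    (isOpen_lt (by fun_prop) continuous_const)

theorem openSimplex_anti {d : ℕ} {b c : Fin d → ℝ} (h : ∀ i, b i ≤ c i) :
    openSimplex c ⊆ openSimplex b := fun _ hx =>
  ⟨hx.1, (Finset.sum_le_sum fun i _ =>
    mul_le_mul_of_nonneg_right (h i) (hx.1 i).le).trans_lt hx.2⟩

theorem openSimplex_nonempty {d : ℕ} {b : Fin d → ℝ} (hb : ∀ i, 0 ≤ b i) :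
    (openSimplex b).Nonempty := by
  have hS : 0 ≤ ∑ i, b i := Finset.sum_nonneg fun i _ => hb i
  refine ⟨fun _ => (∑ i, b i + 1)⁻¹, fun _ => by positivity, ?_⟩
  rw [← Finset.sum_mul, ← div_eq_mul_inv, div_lt_one] <;> linarith

/-- The interior of the simplex `{x | 0 ≤ x, ∑ a i * x i ≤ t}`. -/
theorem interior_simplex {d : ℕ} (hd : 1 ≤ d) {a : Fin d → ℝ} (ha : ∀ i, 0 < a i) {t : ℝ}
    (ht : 0 < t) :
    interior {x : Fin d → ℝ | (∀ i, 0 ≤ x i) ∧ ∑ i, a i * x i ≤ t} =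
      openSimplex (fun i => a i / t) := by
  have hsum : ∀ x : Fin d → ℝ, ∑ i, a i / t * x i = (∑ i, a i * x i) / t := fun x => by
    rw [Finset.sum_div]
    exact Finset.sum_congr rfl fun i _ => by ring
  apply Set.Subset.antisymm
  · intro x hx
    obtain ⟨ε, hε, hball⟩ := Metric.isOpen_iff.1 isOpen_interior x hx
    have hmem : ∀ c : ℝ, |c| < ε → (x + fun _ => c) ∈
        {x : Fin d → ℝ | (∀ i, 0 ≤ x i) ∧ ∑ i, a i * x i ≤ t} := fun c hc => by
      refine interior_subset (hball ?_)
      rw [Metric.mem_ball, dist_eq_norm, add_sub_cancel_left, pi_norm_lt_iff hε]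
      exact fun _ => hc
    have hneg := hmem (-(ε / 2)) (by rw [abs_neg, abs_of_pos] <;> linarith)
    have hpos := hmem (ε / 2) (by rw [abs_of_pos] <;> linarith)
    refine ⟨fun i => ?_, ?_⟩
    · have := hneg.1 i
      simp only [Pi.add_apply] at this
      linarith
    · rw [hsum, div_lt_one ht]
      refine lt_of_lt_of_le (Finset.sum_lt_sum_of_nonempty ⟨⟨0, hd⟩, Finset.mem_univ _⟩
        fun i _ => mul_lt_mul_of_pos_left ?_ (ha i)) hpos.2
      simp only [Pi.add_apply]
      linarith
  · refine interior_maximal (fun x hx => ⟨fun i => (hx.1 i).le, ?_⟩) (isOpen_openSimplex _)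
    have := hx.2
    rw [hsum, div_lt_one ht] at this
    exact this.le

/-- Subgroups containing `ℤ^d` and avoiding an open simplex with coefficients in an ACC set are
controlled by finitely many closed subgroups. -/
theorem exists_finite_closed_subgroups (d : ℕ) {A : Set ℝ} (hA : A ⊆ Set.Ioi 0)
    (hACC : ACCSet A) :
    ∃ 𝒢 : Set (AddSubgroup (Fin d → ℝ)), 𝒢.Finite ∧
      (∀ G ∈ 𝒢, IsClosed (G : Set (Fin d → ℝ)) ∧ intLat d ⊆ (G : Set (Fin d → ℝ)) ∧
        (G : Set (Fin d → ℝ)) ≠ Set.univ) ∧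
      ∀ b : Fin d → ℝ, (∀ i, b i ∈ A) → ∀ N : AddSubgroup (Fin d → ℝ),
        intLat d ⊆ (N : Set (Fin d → ℝ)) → (N : Set (Fin d → ℝ)) ∩ openSimplex b = ∅ →
        ∃ G ∈ 𝒢, N ≤ G ∧ (G : Set (Fin d → ℝ)) ∩ openSimplex b = ∅ := by
  classical
  by_contra hcon
  let valid : Set (AddSubgroup (Fin d → ℝ)) := {G | IsClosed (G : Set (Fin d → ℝ)) ∧
    intLat d ⊆ (G : Set (Fin d → ℝ)) ∧ (G : Set (Fin d → ℝ)) ≠ Set.univ}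
  let P := {p : (Fin d → ℝ) × AddSubgroup (Fin d → ℝ) // (∀ i, p.1 i ∈ A) ∧
    intLat d ⊆ (p.2 : Set (Fin d → ℝ)) ∧ (p.2 : Set (Fin d → ℝ)) ∩ openSimplex p.1 = ∅}
  let uncov : AddSubgroup (Fin d → ℝ) → Set P := fun G =>
    {p | ¬ (p.1.2 ≤ G ∧ (G : Set (Fin d → ℝ)) ∩ openSimplex p.1.1 = ∅)}
  obtain ⟨F, hF⟩ := Ultrafilter.exists_ultrafilter_of_finite_inter_nonempty (uncov '' valid) (by
    intro T hT
    obtain ⟨S, hS, rfl⟩ := Finset.subset_set_image_iff.1 hT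
    by_contra hne
    refine hcon ⟨S, S.finite_toSet, fun G hG => hS hG, fun b hb N hNZ hNb => ?_⟩
    by_contra hex
    refine hne ⟨⟨(b, N), hb, hNZ, hNb⟩, ?_⟩
    simp only [Finset.coe_image, Set.mem_sInter, Set.mem_image]
    rintro _ ⟨G, hG, rfl⟩ hp
    exact hex ⟨G, hG, hp⟩)
  set H := AddSubgroup.lowerLimit (F : Filter P) (fun p => p.1.2) with hHdef
  have hle : ∀ᶠ q in (F : Filter P), q.1.2 ≤ H :=
    AddSubgroup.eventually_le_lowerLimit F _ fun q => q.2.2.1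
  have hmono : ∀ᶠ p in (F : Filter P), ∀ i, ∀ᶠ q in (F : Filter P), q.1.1 i ≤ p.1.1 i :=
    Filter.eventually_all.2 fun i =>
      hACC.eventually_eventually_le F (fun p => p.1.1 i) fun p => p.2.1 i
  have havoid : ∀ᶠ p in (F : Filter P), (H : Set (Fin d → ℝ)) ∩ openSimplex p.1.1 = ∅ := by
    filter_upwards [hmono] with p hp
    rw [Set.eq_empty_iff_forall_notMem]
    rintro x ⟨hxH, hxp⟩
    obtain ⟨ε, hε, hball⟩ := Metric.isOpen_iff.1 (isOpen_openSimplex p.1.1) x hxp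
    obtain ⟨q, hq, y, hy, hyx⟩ := ((Filter.eventually_all.2 hp).and (hxH ε hε)).exists
    refine Set.eq_empty_iff_forall_notMem.1 q.2.2.2 y ⟨hy, openSimplex_anti hq (hball ?_)⟩
    rwa [Metric.mem_ball, dist_eq_norm]
  have hvalid : H ∈ valid := by
    refine ⟨AddSubgroup.isClosed_lowerLimit _ _, fun z hz ε hε =>
      Filter.Eventually.of_forall fun q => ⟨z, q.2.2.1 hz, by simpa using hε⟩, fun huniv => ?_⟩
    obtain ⟨p, hp⟩ := havoid.exists
    obtain ⟨x, hx⟩ := openSimplex_nonempty fun i => (hA (p.2.1 i)).le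
    rw [huniv, Set.univ_inter] at hp
    exact Set.eq_empty_iff_forall_notMem.1 hp x hx
  have hun : ∀ᶠ p in (F : Filter P), p ∈ uncov H := hF ⟨H, hvalid, rfl⟩
  obtain ⟨p, hp1, hp2, hp3⟩ := (hle.and (havoid.and hun)).exists
  exact hp3 ⟨hp1, hp2⟩

/-- **Borisov's series, local form.** Fix `d ≥ 1` and an ACC set
`A ⊆ (0, ∞)`. There are finitely many closed subgroups `ℤ^d ≤ G ≨ ℝ^d` such that for every
`t > 0` and positive `a_1, …, a_d` with `a_i / t ∈ A`, setting
`W = {x : x_i ≥ 0, Σ a_i x_i ≤ t}`, a discrete subgroup `N` with `ℤ^d ⊆ N ⊆ ℝ^d` in which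
each standard basis vector is primitive satisfies `N ∩ int W = ∅` if and only if `N` is
contained in some `G` of the family with `G ∩ int W = ∅`. -/
theorem stmt_19 (d : ℕ) (hd : 1 ≤ d) (A : Set ℝ) (hA : A ⊆ Set.Ioi 0) (hACC : ACCSet A) :
    ∃ 𝒢 : Set (AddSubgroup (Fin d → ℝ)), 𝒢.Finite ∧
      (∀ G ∈ 𝒢, IsClosed (G : Set (Fin d → ℝ)) ∧ intLat d ⊆ (G : Set (Fin d → ℝ)) ∧
        (G : Set (Fin d → ℝ)) ≠ Set.univ) ∧
      ∀ t : ℝ, 0 < t → ∀ a : Fin d → ℝ, (∀ i, 0 < a i) → (∀ i, a i / t ∈ A) →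
      ∀ W : Set (Fin d → ℝ), W = {x | (∀ i, 0 ≤ x i) ∧ ∑ i, a i * x i ≤ t} →
      ∀ N : AddSubgroup (Fin d → ℝ),
        (∃ Uu ∈ nhds (0 : Fin d → ℝ), (N : Set (Fin d → ℝ)) ∩ Uu = {0}) →
        intLat d ⊆ (N : Set (Fin d → ℝ)) →
        (∀ i : Fin d, ∀ k : ℤ, 2 ≤ k → ((k : ℝ)⁻¹ • (Pi.single i 1 : Fin d → ℝ)) ∉ N) →
        (((N : Set (Fin d → ℝ)) ∩ interior W = ∅) ↔
          ∃ G ∈ 𝒢, (N : Set (Fin d → ℝ)) ⊆ (G : Set (Fin d → ℝ)) ∧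
            (G : Set (Fin d → ℝ)) ∩ interior W = ∅) := by
  obtain ⟨𝒢, hfin, hvalid, hcover⟩ := exists_finite_closed_subgroups d hA hACC
  refine ⟨𝒢, hfin, hvalid, ?_⟩
  rintro t ht a ha haA W rfl N - hNZ -
  rw [interior_simplex hd ha ht]
  refine ⟨fun h => hcover _ haA N hNZ h, ?_⟩
  rintro ⟨G, -, hNG, hG⟩
  exact Set.subset_eq_empty (Set.inter_subset_inter_left _ hNG) hG
end
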